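/- arXiv:1809.02703 — 3 statements merged into one kernel-verified Lean document; each statement's English description precedes it below -/
import Mathlib

section
/- The sets C_G, C_FL, and C_R are pairwise disjoint and their union is all of Ω; that is, Ω = C_G ∪ C_FL ∪ C_R is a partition of the state space. -/
open Finset

/-! Six-vertex model on the `n × n` square lattice region `Λ_n` with free
boundary conditions.

`Edge.horiz k j` is the horizontal edge between `x = k-1` and `x = k` at
height `j`; `Edge.vert i k` is the vertical edge between `y = k-1` and
`y = k` on column `i`.  The vertices of `Λ_n` are the pairs
`(i, j) : Fin n × Fin n`.  An edge configuration assigns `true`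
(rightwards / upwards) or `false` (leftwards / downwards) to every edge. -/
inductive Edge (n : ℕ) : Type
  | horiz (k : Fin (n + 1)) (j : Fin n) : Edge n
  | vert (i : Fin n) (k : Fin (n + 1)) : Edge n
  deriving DecidableEq, Fintype

abbrev EdgeConfig (n : ℕ) := Edge n → Bool

/-- The four edges incident to the vertex `(i, j)` of `Λ_n`. -/
def leftE {n : ℕ} (i j : Fin n) : Edge n := Edge.horiz i.castSucc j
def rightE {n : ℕ} (i j : Fin n) : Edge n := Edge.horiz i.succ j
def botE {n : ℕ} (i j : Fin n) : Edge n := Edge.vert i j.castSucc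
def topE {n : ℕ} (i j : Fin n) : Edge n := Edge.vert i j.succ

/-- The in-degree of the vertex `(i, j)` in the configuration `τ`. -/
def inDegree {n : ℕ} (τ : EdgeConfig n) (i j : Fin n) : ℕ :=
  (cond (τ (leftE i j)) 1 0) + (cond (τ (rightE i j)) 0 1) +
    (cond (τ (botE i j)) 1 0) + (cond (τ (topE i j)) 0 1)

/-- The ice rule: every vertex has exactly two incoming (and hence two
outgoing) incident edges; such a configuration is an Eulerian orientation. -/
def IceRule {n : ℕ} (τ : EdgeConfig n) : Prop :=
  ∀ i j : Fin n, inDegree τ i j = 2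

instance {n : ℕ} (τ : EdgeConfig n) : Decidable (IceRule τ) :=
  inferInstanceAs (Decidable (∀ i j : Fin n, inDegree τ i j = 2))

/-- `Ω`, the state space: all Eulerian orientations of `Λ_n`. -/
def OmegaSet (n : ℕ) : Set (EdgeConfig n) := {τ | IceRule τ}

/-- The state `τ_G`, in which every vertex has six-vertex type `c`. -/
def greenOrient {n : ℕ} : Edge n → Bool
  | Edge.horiz k j => (k.val + j.val) % 2 == 0
  | Edge.vert i k => (i.val + k.val) % 2 == 1

def tauG (n : ℕ) : EdgeConfig n := greenOrient

/-- The state `τ_R`, the total edge reversal of `τ_G`. -/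
def tauR (n : ℕ) : EdgeConfig n := fun e => !(greenOrient e)

/-- An edge is green in `τ` if it is oriented as in `τ_G`, red otherwise. -/
def greenB {n : ℕ} (τ : EdgeConfig n) (e : Edge n) : Bool := τ e == greenOrient e

def IsGreen {n : ℕ} (τ : EdgeConfig n) (e : Edge n) : Prop := τ e = greenOrient e
def IsRed {n : ℕ} (τ : EdgeConfig n) (e : Edge n) : Prop := τ e = !(greenOrient e)

/-- Incidence between edges and vertices of `Λ_n`. -/
def EdgeIncident {n : ℕ} : Edge n → Fin n × Fin n → Prop
  | Edge.horiz k j', (i, j) => j' = j ∧ (k = i.castSucc ∨ k = i.succ)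
  | Edge.vert i' k, (i, j) => i' = i ∧ (k = j.castSucc ∨ k = j.succ)

/-- Two (distinct) edges are adjacent if they share an incident `Λ_n`-vertex. -/
def EdgeAdj {n : ℕ} (e f : Edge n) : Prop :=
  e ≠ f ∧ ∃ v : Fin n × Fin n, EdgeIncident e v ∧ EdgeIncident f v

/-- A simple (self-avoiding) monochromatic path of edges of colour `g`
(`true` = green, `false` = red). -/
def MonoPath {n : ℕ} (τ : EdgeConfig n) (g : Bool) (p : List (Edge n)) : Prop :=
  p ≠ [] ∧ p.Nodup ∧ List.Chain' EdgeAdj p ∧ ∀ e ∈ p, greenB τ e = g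

/-- A horizontal monochromatic bridge: a simple monochromatic path from a
horizontal edge on the left boundary to a horizontal edge on the right
boundary of `Λ_n`. -/
def IsHorizBridge {n : ℕ} (τ : EdgeConfig n) (g : Bool) (p : List (Edge n)) : Prop :=
  MonoPath τ g p ∧ (∃ j, p.head? = some (Edge.horiz 0 j)) ∧
    (∃ j, p.getLast? = some (Edge.horiz (Fin.last n) j))

/-- A vertical monochromatic bridge, from the top boundary to the bottom. -/
def IsVertBridge {n : ℕ} (τ : EdgeConfig n) (g : Bool) (p : List (Edge n)) : Prop :=
  MonoPath τ g p ∧ (∃ i, p.head? = some (Edge.vert i (Fin.last n))) ∧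
    (∃ i, p.getLast? = some (Edge.vert i 0))

def HorizGreenBridge {n : ℕ} (τ : EdgeConfig n) : Prop := ∃ p, IsHorizBridge τ true p
def HorizRedBridge {n : ℕ} (τ : EdgeConfig n) : Prop := ∃ p, IsHorizBridge τ false p
def VertGreenBridge {n : ℕ} (τ : EdgeConfig n) : Prop := ∃ p, IsVertBridge τ true p
def VertRedBridge {n : ℕ} (τ : EdgeConfig n) : Prop := ∃ p, IsVertBridge τ false p

def HasGreenCross {n : ℕ} (τ : EdgeConfig n) : Prop :=
  HorizGreenBridge τ ∧ VertGreenBridge τ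

def HasRedCross {n : ℕ} (τ : EdgeConfig n) : Prop :=
  HorizRedBridge τ ∧ VertRedBridge τ

/-- `C_G`: the states with a green cross. -/
def CG (n : ℕ) : Set (EdgeConfig n) := {τ | IceRule τ ∧ HasGreenCross τ}

/-- `C_R`: the states with a red cross. -/
def CR (n : ℕ) : Set (EdgeConfig n) := {τ | IceRule τ ∧ HasRedCross τ}

/-! The shifted lattice `L = ℤ² + (1/2, 1/2)`, restricted to the region inside
`Λ_n`.  The `L_n`-vertex `(i, j) : Fin (n+1) × Fin (n+1)` represents the point
`(i - 1/2, j - 1/2)`; its boundary vertices are those with a coordinate equal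
to `0` or `n`.  An `L_n`-edge is a diagonal passing through exactly one
`Λ_n`-vertex; it is recorded as that `Λ_n`-vertex together with a Boolean
(`true` for the NE–SW diagonal, `false` for the NW–SE diagonal). -/
abbrev LVertex (n : ℕ) := Fin (n + 1) × Fin (n + 1)

abbrev LEdge (n : ℕ) := (Fin n × Fin n) × Bool

/-- The two `L_n`-endpoints of an `L_n`-edge. -/
def lEdgeEnds {n : ℕ} : LEdge n → LVertex n × LVertex n
  | ((i, j), true) => ((i.castSucc, j.castSucc), (i.succ, j.succ))
  | ((i, j), false) => ((i.succ, j.castSucc), (i.castSucc, j.succ))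

/-- The `L_n`-edge `e` joins the `L_n`-vertices `u` and `v`. -/
def StepOnEdge {n : ℕ} (e : LEdge n) (u v : LVertex n) : Prop :=
  lEdgeEnds e = (u, v) ∨ lEdgeEnds e = (v, u)

/-- Adjacency in the lattice `L_n`. -/
def LAdjacent {n : ℕ} (u v : LVertex n) : Prop :=
  ∃ e : LEdge n, StepOnEdge e u v

/-- Membership of an `L_n`-edge in `L_τ`: the four `Λ_n`-edges incident to the
`Λ_n`-vertex it passes through are two green and two red, and the edge
separates the two green edges from the two red ones. -/
def lTau {n : ℕ} (τ : EdgeConfig n) : LEdge n → Bool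
  | ((i, j), true) =>
      (greenB τ (leftE i j) == greenB τ (topE i j)) &&
        (greenB τ (rightE i j) == greenB τ (botE i j)) &&
        !(greenB τ (leftE i j) == greenB τ (rightE i j))
  | ((i, j), false) =>
      (greenB τ (leftE i j) == greenB τ (botE i j)) &&
        (greenB τ (rightE i j) == greenB τ (topE i j)) &&
        !(greenB τ (leftE i j) == greenB τ (rightE i j))

/-- A step between two `L_n`-vertices along an edge of `L_τ`. -/
def LStep {n : ℕ} (τ : EdgeConfig n) (u v : LVertex n) : Prop :=
  ∃ e : LEdge n, StepOnEdge e u v ∧ lTau τ e = true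

/-- The consecutive steps of a path given as a list of vertices. -/
def pathSteps {α : Type*} (p : List α) : List (α × α) := p.zip p.tail

/-- A vertical fault line: a self-avoiding path of `L_τ`-edges from an
`L_n`-vertex on the top boundary to an `L_n`-vertex on the bottom boundary. -/
def IsVertFaultLine {n : ℕ} (τ : EdgeConfig n) (p : List (LVertex n)) : Prop :=
  p ≠ [] ∧ p.Nodup ∧ List.Chain' (LStep τ) p ∧
    (∃ u, p.head? = some u ∧ u.2 = Fin.last n) ∧
    (∃ u, p.getLast? = some u ∧ u.2 = 0)

/-- A horizontal fault line: from the left boundary to the right boundary. -/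
def IsHorizFaultLine {n : ℕ} (τ : EdgeConfig n) (p : List (LVertex n)) : Prop :=
  p ≠ [] ∧ p.Nodup ∧ List.Chain' (LStep τ) p ∧
    (∃ u, p.head? = some u ∧ u.1 = 0) ∧
    (∃ u, p.getLast? = some u ∧ u.1 = Fin.last n)

def HasVertFaultLine {n : ℕ} (τ : EdgeConfig n) : Prop := ∃ p, IsVertFaultLine τ p
def HasHorizFaultLine {n : ℕ} (τ : EdgeConfig n) : Prop := ∃ p, IsHorizFaultLine τ p

/-- `C_FL`: the states with a (horizontal or vertical) fault line. -/
def CFL (n : ℕ) : Set (EdgeConfig n) :=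
  {τ | IceRule τ ∧ (HasHorizFaultLine τ ∨ HasVertFaultLine τ)}

/-- A vertical almost fault line: a self-avoiding `L_n`-path from the top
boundary to the bottom boundary all of whose edges except exactly one
belong to `L_τ`. -/
def IsVertAlmostFaultLine {n : ℕ} (τ : EdgeConfig n) (p : List (LVertex n)) : Prop :=
  p ≠ [] ∧ p.Nodup ∧ List.Chain' LAdjacent p ∧
    (∃ u, p.head? = some u ∧ u.2 = Fin.last n) ∧
    (∃ u, p.getLast? = some u ∧ u.2 = 0) ∧
    ∃ s ∈ pathSteps p, ¬ LStep τ s.1 s.2 ∧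
      ∀ t ∈ pathSteps p, t ≠ s → LStep τ t.1 t.2

/-- A horizontal almost fault line. -/
def IsHorizAlmostFaultLine {n : ℕ} (τ : EdgeConfig n) (p : List (LVertex n)) : Prop :=
  p ≠ [] ∧ p.Nodup ∧ List.Chain' LAdjacent p ∧
    (∃ u, p.head? = some u ∧ u.1 = 0) ∧
    (∃ u, p.getLast? = some u ∧ u.1 = Fin.last n) ∧
    ∃ s ∈ pathSteps p, ¬ LStep τ s.1 s.2 ∧
      ∀ t ∈ pathSteps p, t ≠ s → LStep τ t.1 t.2

/-- `C_AFL`: the states with an almost fault line. -/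
def CAFL (n : ℕ) : Set (EdgeConfig n) :=
  {τ | IceRule τ ∧
    ((∃ p, IsHorizAlmostFaultLine τ p) ∨ (∃ p, IsVertAlmostFaultLine τ p))}

/-- The weight of the vertex `(i, j)`: `c` for the two `c`-type configurations
(both horizontal edges in, or both out), and `a` or `b` for the others. -/
noncomputable def vertexWeight {n : ℕ} (a b c : ℝ) (τ : EdgeConfig n)
    (i j : Fin n) : ℝ :=
  if τ (leftE i j) ≠ τ (rightE i j) then c
  else if τ (leftE i j) = τ (botE i j) then a else b

/-- The weight `w(τ)` of a state: the product of the vertex weights. -/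
noncomputable def weight {n : ℕ} (a b c : ℝ) (τ : EdgeConfig n) : ℝ :=
  ∏ v : Fin n × Fin n, vertexWeight a b c τ v.1 v.2

/-- The partition function `Z`. -/
noncomputable def Zsum (n : ℕ) (a b c : ℝ) : ℝ :=
  ∑ τ ∈ Finset.univ.filter (fun τ : EdgeConfig n => IceRule τ), weight a b c τ

open Classical in
/-- The Gibbs measure of a set of states, `π(S) = (Σ_{τ∈S} w(τ))/Z`. -/
noncomputable def piSet (n : ℕ) (a b c : ℝ) (S : Set (EdgeConfig n)) : ℝ :=
  (∑ τ ∈ Finset.univ.filter (fun τ : EdgeConfig n => τ ∈ S), weight a b c τ) /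
    Zsum n a b c

/-- The four edges (bottom, right, top, left) of the unit square of `ℤ²`
whose lower-left corner is the `Λ_n`-vertex `(i, j)`. -/
def squareEdges (n : ℕ) (i j : ℕ) (hi : i + 1 < n) (hj : j + 1 < n) :
    Edge n × Edge n × Edge n × Edge n :=
  (Edge.horiz ⟨i + 1, by omega⟩ ⟨j, by omega⟩,
    Edge.vert ⟨i + 1, by omega⟩ ⟨j + 1, by omega⟩,
    Edge.horiz ⟨i + 1, by omega⟩ ⟨j + 1, by omega⟩,
    Edge.vert ⟨i, by omega⟩ ⟨j + 1, by omega⟩)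

/-- The four edges (bottom, right, top, left) around a unit square form a
directed cycle, i.e. are consistently oriented. -/
def DirectedSquare {n : ℕ} (τ : EdgeConfig n)
    (e : Edge n × Edge n × Edge n × Edge n) : Prop :=
  (τ e.1 = true ∧ τ e.2.1 = true ∧ τ e.2.2.1 = false ∧ τ e.2.2.2 = false) ∨
    (τ e.1 = false ∧ τ e.2.1 = false ∧ τ e.2.2.1 = true ∧ τ e.2.2.2 = true)

/-- Reversing the orientations of the four edges around a unit square. -/
def flipSquare {n : ℕ} (τ : EdgeConfig n)
    (e : Edge n × Edge n × Edge n × Edge n) : EdgeConfig n :=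
  fun f => if f = e.1 ∨ f = e.2.1 ∨ f = e.2.2.1 ∨ f = e.2.2.2 then !(τ f) else τ f

/-- A move of the Glauber dynamics `M_G` at the unit square with lower-left
corner `(i, j)`: the four edges around the square are consistently oriented
in `τ`, and `τ'` is obtained from `τ` by reversing them. -/
def GlauberMoveAt {n : ℕ} (τ τ' : EdgeConfig n) (i j : ℕ)
    (hi : i + 1 < n) (hj : j + 1 < n) : Prop :=
  DirectedSquare τ (squareEdges n i j hi hj) ∧
    τ' = flipSquare τ (squareEdges n i j hi hj)

/-- A move of the Glauber dynamics `M_G`. -/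
def GlauberMove {n : ℕ} (τ τ' : EdgeConfig n) : Prop :=
  ∃ (i j : ℕ) (hi : i + 1 < n) (hj : j + 1 < n), GlauberMoveAt τ τ' i j hi hj

/-- `∂C_G`: the states outside `C_G` that are one move of `M_G` away from
`C_G`. -/
def boundaryCG (n : ℕ) : Set (EdgeConfig n) :=
  {τ | IceRule τ ∧ τ ∉ CG n ∧ ∃ σ ∈ CG n, GlauberMove σ τ}

/-- The state space `Ω` as a type. -/
abbrev OmegaT (n : ℕ) := {τ : EdgeConfig n // IceRule τ}

open Classical in
/-- Metropolis transition rate of `M_G` between two distinct states: propose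
one of the `(n-1)²` unit squares uniformly at random and accept the flip with
probability `min 1 (w(τ')/w(τ))`. -/
noncomputable def metro {n : ℕ} (a b c : ℝ) (τ τ' : OmegaT n) : ℝ :=
  if GlauberMove τ.1 τ'.1 then
    (1 / (((n : ℝ) - 1) * ((n : ℝ) - 1))) *
      min 1 (weight a b c τ'.1 / weight a b c τ.1)
  else 0

/-- The transition matrix of the Glauber dynamics `M_G`. -/
noncomputable def transP {n : ℕ} (a b c : ℝ) (τ τ' : OmegaT n) : ℝ :=
  if τ' = τ then 1 - ∑ σ ∈ Finset.univ.erase τ, metro a b c τ σ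
  else metro a b c τ τ'

/-- The `t`-step transition probabilities of `M_G`. -/
noncomputable def transPow {n : ℕ} (a b c : ℝ) : ℕ → OmegaT n → OmegaT n → ℝ
  | 0, τ, τ' => if τ = τ' then 1 else 0
  | t + 1, τ, τ' => ∑ σ : OmegaT n, transPow a b c t τ σ * transP a b c σ τ'

/-- The stationary Gibbs distribution `π` on `Ω`. -/
noncomputable def piDist {n : ℕ} (a b c : ℝ) (τ : OmegaT n) : ℝ :=
  weight a b c τ.1 / Zsum n a b c

/-- Total variation distance between two distributions on `Ω`. -/
noncomputable def tvDist {n : ℕ} (μ ν : OmegaT n → ℝ) : ℝ :=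
  (∑ τ : OmegaT n, |μ τ - ν τ|) / 2

/-- The mixing time of `M_G`: the smallest `t` after which the total variation
distance to `π` is at most `1/4` from any starting state. -/
noncomputable def mixingTime (n : ℕ) (a b c : ℝ) : ℕ :=
  sInf {t : ℕ | ∀ τ₀ : OmegaT n,
    tvDist (transPow a b c t τ₀) (piDist a b c) ≤ 1 / 4}

/-- The number of green edges incident to the vertex `(i, j)` in `τ`. -/
def greenCountAt {n : ℕ} (τ : EdgeConfig n) (i j : Fin n) : ℕ :=
  (cond (greenB τ (leftE i j)) 1 0) + (cond (greenB τ (rightE i j)) 1 0) +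
    (cond (greenB τ (botE i j)) 1 0) + (cond (greenB τ (topE i j)) 1 0)

/-- The number of `L_τ`-edges incident to the `L_n`-vertex `u`. -/
def lTauDegree {n : ℕ} (τ : EdgeConfig n) (u : LVertex n) : ℕ :=
  (Finset.univ.filter (fun e : LEdge n =>
    lTau τ e = true ∧ ((lEdgeEnds e).1 = u ∨ (lEdgeEnds e).2 = u))).card

/-- The number of colour changes encountered when going rotationally
(bottom, right, top, left) around the four `Λ_n`-edges surrounding the
internal `L_n`-vertex `(i, j)` (representing the point `(i - 1/2, j - 1/2)`). -/
def colorChangesAround (n : ℕ) (τ : EdgeConfig n) (i j : ℕ)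
    (hi0 : 0 < i) (hin : i < n) (hj0 : 0 < j) (hjn : j < n) : ℕ :=
  let bo := greenB τ (Edge.horiz ⟨i, by omega⟩ ⟨j - 1, by omega⟩)
  let t := greenB τ (Edge.horiz ⟨i, by omega⟩ ⟨j, by omega⟩)
  let l := greenB τ (Edge.vert ⟨i - 1, by omega⟩ ⟨j, by omega⟩)
  let r := greenB τ (Edge.vert ⟨i, by omega⟩ ⟨j, by omega⟩)
  (cond (bo != r) 1 0) + (cond (r != t) 1 0) +
    (cond (t != l) 1 0) + (cond (l != bo) 1 0)

/-! ### Paths and reachability -/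

theorem exists_nodup_isChain_of_reflTransGen {α : Type*} {r : α → α → Prop}
    (hs : ∀ a b, r a b → r b a) (hi : ∀ a, ¬ r a a) {a b : α}
    (h : Relation.ReflTransGen r a b) :
    ∃ p : List α, p ≠ [] ∧ p.Nodup ∧ List.IsChain r p ∧
      p.head? = some a ∧ p.getLast? = some b := by
  classical
  let G : SimpleGraph α := { Adj := r, symm := ⟨hs⟩, loopless := ⟨hi⟩ }
  obtain ⟨w⟩ : G.Reachable a b := (SimpleGraph.reachable_iff_reflTransGen a b).2 h
  refine ⟨w.toPath.1.support, w.toPath.1.support_ne_nil, w.toPath.2.support_nodup,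
    w.toPath.1.isChain_adj_support, ?_, ?_⟩
  · rw [List.head?_eq_some_head w.toPath.1.support_ne_nil, SimpleGraph.Walk.head_support]
  · rw [List.getLast?_eq_some_getLast w.toPath.1.support_ne_nil,
      SimpleGraph.Walk.getLast_support]

theorem reflTransGen_of_isChain_of_head?_of_getLast? {α : Type*} {r : α → α → Prop}
    {p : List α} (hp : List.IsChain r p) {a b : α} (ha : p.head? = some a)
    (hb : p.getLast? = some b) : Relation.ReflTransGen r a b := by
  have hne : p ≠ [] := by rintro rfl; simp at ha
  rw [List.head?_eq_some_head hne, Option.some_inj] at ha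
  rw [List.getLast?_eq_some_getLast hne, Option.some_inj] at hb
  exact ha ▸ hb ▸ List.relationReflTransGen_of_exists_isChain p hp hne

theorem reflTransGen_symm {α : Type*} {r : α → α → Prop} (hs : ∀ a b, r a b → r b a)
    {a b : α} (h : Relation.ReflTransGen r a b) : Relation.ReflTransGen r b a :=
  Relation.ReflTransGen.mono (fun x y hxy => hs y x hxy) _ _ h.swap

/-! ### Colourings of the edges -/

/-- At every vertex, either all incident edges have the same colour, or two colours occur and
they are separated by one of the two diagonals. -/
def DiagonalRule {n : ℕ} (col : Edge n → Bool) : Prop :=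
  ∀ i j : Fin n,
    (col (leftE i j) = col (rightE i j) ∧ col (leftE i j) = col (botE i j) ∧
      col (leftE i j) = col (topE i j)) ∨
    (col (leftE i j) = col (topE i j) ∧ col (rightE i j) = col (botE i j) ∧
      col (leftE i j) ≠ col (rightE i j)) ∨
    (col (leftE i j) = col (botE i j) ∧ col (rightE i j) = col (topE i j) ∧
      col (leftE i j) ≠ col (rightE i j))

theorem IceRule.diagonalRule {n : ℕ} {τ : EdgeConfig n} (h : IceRule τ) :
    DiagonalRule (greenB τ) := by
  intro i j
  have hij := h i j
  have h1 : greenOrient (leftE i j) = ((i.val + j.val) % 2 == 0) := rfl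
  have h2 : greenOrient (rightE i j) = !((i.val + j.val) % 2 == 0) := by
    change ((i.succ.val + j.val) % 2 == 0) = _
    rw [Fin.val_succ, Bool.eq_iff_iff]
    simp only [beq_iff_eq, Bool.not_eq_true', beq_eq_false_iff_ne]
    omega
  have h3 : greenOrient (botE i j) = !((i.val + j.val) % 2 == 0) := by
    change ((i.val + j.castSucc.val) % 2 == 1) = _
    rw [Fin.val_castSucc, Bool.eq_iff_iff]
    simp only [beq_iff_eq, Bool.not_eq_true', beq_eq_false_iff_ne]
    omega
  have h4 : greenOrient (topE i j) = ((i.val + j.val) % 2 == 0) := by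
    change ((i.val + j.succ.val) % 2 == 1) = _
    rw [Fin.val_succ, Bool.eq_iff_iff]
    simp only [beq_iff_eq]
    omega
  simp only [greenB, h1, h2, h3, h4]
  unfold inDegree at hij
  generalize ((i.val + j.val) % 2 == 0) = p
  clear h h1 h2 h3 h4
  revert hij
  generalize τ (leftE i j) = a
  generalize τ (rightE i j) = b
  generalize τ (botE i j) = c
  generalize τ (topE i j) = d
  revert p a b c d
  decide

/-- The diagonal `e` separates two edges of one colour from two edges of the other colour. -/
def Separates {n : ℕ} (col : Edge n → Bool) : LEdge n → Prop
  | ((i, j), true) => col (leftE i j) = col (topE i j) ∧ col (rightE i j) = col (botE i j) ∧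
      col (leftE i j) ≠ col (rightE i j)
  | ((i, j), false) => col (leftE i j) = col (botE i j) ∧ col (rightE i j) = col (topE i j) ∧
      col (leftE i j) ≠ col (rightE i j)

/-- A step between two `L_n`-vertices along a separating diagonal. -/
def SepStep {n : ℕ} (col : Edge n → Bool) (u v : LVertex n) : Prop :=
  ∃ e : LEdge n, StepOnEdge e u v ∧ Separates col e

theorem lStep_iff_sepStep {n : ℕ} {τ : EdgeConfig n} {u v : LVertex n} :
    LStep τ u v ↔ SepStep (greenB τ) u v := by
  refine exists_congr fun e => and_congr_right fun _ => ?_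
  obtain ⟨⟨i, j⟩, _ | _⟩ := e <;> simp [lTau, Separates, and_assoc]

theorem SepStep.symm {n : ℕ} {col : Edge n → Bool} {u v : LVertex n} (h : SepStep col u v) :
    SepStep col v u :=
  let ⟨e, h1, h2⟩ := h
  ⟨e, Or.symm h1, h2⟩

theorem SepStep.ne {n : ℕ} {col : Edge n → Bool} {u v : LVertex n} (h : SepStep col u v) :
    u ≠ v := by
  obtain ⟨⟨⟨i, j⟩, _ | _⟩, h | h, -⟩ := h <;> rintro rfl <;>
    simp [lEdgeEnds, Prod.ext_iff, Fin.ext_iff] at h <;> omega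

/-- Adjacent edges of the same colour. -/
def MonoStep {n : ℕ} (col : Edge n → Bool) (e f : Edge n) : Prop :=
  EdgeAdj e f ∧ col e = col f

theorem MonoStep.symm {n : ℕ} {col : Edge n → Bool} {e f : Edge n} (h : MonoStep col e f) :
    MonoStep col f e :=
  let ⟨⟨h1, v, h2, h3⟩, h4⟩ := h
  ⟨⟨h1.symm, v, h3, h2⟩, h4.symm⟩

theorem edgeIncident_iff {n : ℕ} {e : Edge n} {i j : Fin n} :
    EdgeIncident e (i, j) ↔ e = leftE i j ∨ e = rightE i j ∨ e = botE i j ∨ e = topE i j := by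
  cases e <;> simp [EdgeIncident, leftE, rightE, botE, topE] <;> grind

theorem MonoStep.reflTransGen_of_incident {n : ℕ} {col : Edge n → Bool} {e f : Edge n}
    {v : Fin n × Fin n} (he : EdgeIncident e v) (hf : EdgeIncident f v) (h : col e = col f) :
    Relation.ReflTransGen (MonoStep col) e f := by
  by_cases hef : e = f
  · exact hef ▸ .refl
  · exact .single ⟨⟨hef, v, he, hf⟩, h⟩

theorem col_eq_of_reflTransGen {n : ℕ} {col : Edge n → Bool} {e f : Edge n}
    (h : Relation.ReflTransGen (MonoStep col) e f) : col e = col f := by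
  induction h with
  | refl => rfl
  | tail _ h ih => exact ih.trans h.2

theorem exists_monoPath_iff {n : ℕ} {τ : EdgeConfig n} {g : Bool} {e f : Edge n} :
    (∃ p, MonoPath τ g p ∧ p.head? = some e ∧ p.getLast? = some f) ↔
      greenB τ e = g ∧ Relation.ReflTransGen (MonoStep (greenB τ)) e f := by
  constructor
  · rintro ⟨p, ⟨-, -, hc, hg⟩, he, hf⟩
    refine ⟨hg e (List.mem_of_mem_head? he), ?_⟩
    refine reflTransGen_of_isChain_of_head?_of_getLast? ?_ he hf
    exact List.IsChain.imp_of_mem_imp (fun a b ha hb hab =>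
      ⟨hab, (hg a ha).trans (hg b hb).symm⟩) hc
  · rintro ⟨rfl, h⟩
    obtain ⟨p, h1, h2, h3, h4, h5⟩ := exists_nodup_isChain_of_reflTransGen
      (fun _ _ => MonoStep.symm) (fun _ h => h.1.1 rfl) h
    refine ⟨p, ⟨h1, h2, h3.imp fun _ _ => And.left, ?_⟩, h4, h5⟩
    refine List.IsChain.induction (fun x => greenB τ x = greenB τ e) p h3
      (fun x y hxy hx => hxy.2.symm.trans hx) fun lne => ?_
    rw [List.head?_eq_some_head lne, Option.some_inj] at h4
    rw [h4]

/-- There is a horizontal bridge of colour `g`. -/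
def HorizBridge {n : ℕ} (col : Edge n → Bool) (g : Bool) : Prop :=
  ∃ j l, col (Edge.horiz 0 j) = g ∧
    Relation.ReflTransGen (MonoStep col) (Edge.horiz 0 j) (Edge.horiz (Fin.last n) l)

/-- There is a vertical bridge of colour `g`. -/
def VertBridge {n : ℕ} (col : Edge n → Bool) (g : Bool) : Prop :=
  ∃ i m, col (Edge.vert i (Fin.last n)) = g ∧
    Relation.ReflTransGen (MonoStep col) (Edge.vert i (Fin.last n)) (Edge.vert m 0)

/-- There is a horizontal fault line. -/
def HorizFault {n : ℕ} (col : Edge n → Bool) : Prop :=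
  ∃ u v : LVertex n, u.1 = 0 ∧ v.1 = Fin.last n ∧ Relation.ReflTransGen (SepStep col) u v

/-- There is a vertical fault line. -/
def VertFault {n : ℕ} (col : Edge n → Bool) : Prop :=
  ∃ u v : LVertex n, u.2 = Fin.last n ∧ v.2 = 0 ∧ Relation.ReflTransGen (SepStep col) u v

theorem exists_isHorizBridge_iff {n : ℕ} {τ : EdgeConfig n} {g : Bool} :
    (∃ p, IsHorizBridge τ g p) ↔ HorizBridge (greenB τ) g := by
  simp only [HorizBridge, ← exists_monoPath_iff, IsHorizBridge]
  grind

theorem exists_isVertBridge_iff {n : ℕ} {τ : EdgeConfig n} {g : Bool} :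
    (∃ p, IsVertBridge τ g p) ↔ VertBridge (greenB τ) g := by
  simp only [VertBridge, ← exists_monoPath_iff, IsVertBridge]
  grind

theorem exists_sepPath_iff {n : ℕ} {τ : EdgeConfig n} {u v : LVertex n} :
    (∃ p : List (LVertex n), p ≠ [] ∧ p.Nodup ∧ List.Chain' (LStep τ) p ∧ p.head? = some u ∧
      p.getLast? = some v) ↔ Relation.ReflTransGen (SepStep (greenB τ)) u v := by
  have hr : LStep τ = SepStep (greenB τ) := by
    ext u v
    exact lStep_iff_sepStep
  rw [hr]
  constructor
  · rintro ⟨p, -, -, h, hu, hv⟩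
    exact reflTransGen_of_isChain_of_head?_of_getLast? h hu hv
  · exact exists_nodup_isChain_of_reflTransGen (fun _ _ => SepStep.symm) fun _ h => h.ne rfl

theorem hasHorizFaultLine_iff {n : ℕ} {τ : EdgeConfig n} :
    HasHorizFaultLine τ ↔ HorizFault (greenB τ) := by
  simp only [HorizFault, ← exists_sepPath_iff, HasHorizFaultLine, IsHorizFaultLine]
  grind

theorem hasVertFaultLine_iff {n : ℕ} {τ : EdgeConfig n} :
    HasVertFaultLine τ ↔ VertFault (greenB τ) := by
  simp only [VertFault, ← exists_sepPath_iff, HasVertFaultLine, IsVertFaultLine]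
  grind

/-! ### Reflection in the main diagonal -/

/-- Reflection of edges in the main diagonal. -/
def Edge.transpose {n : ℕ} : Edge n → Edge n
  | Edge.horiz k j => Edge.vert j k
  | Edge.vert i k => Edge.horiz k i

theorem Edge.transpose_transpose {n : ℕ} (e : Edge n) : e.transpose.transpose = e := by
  cases e <;> rfl

theorem DiagonalRule.transpose {n : ℕ} {col : Edge n → Bool} (h : DiagonalRule col) :
    DiagonalRule (col ∘ Edge.transpose) := by
  intro i j
  have := h j i
  simp only [leftE, rightE, botE, topE, Function.comp, Edge.transpose] at this ⊢
  grind

theorem MonoStep.transpose {n : ℕ} {col : Edge n → Bool} {e f : Edge n}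
    (h : MonoStep (col ∘ Edge.transpose) e f) : MonoStep col e.transpose f.transpose := by
  obtain ⟨⟨hne, ⟨i, j⟩, he, hf⟩, hc⟩ := h
  refine ⟨⟨fun h => hne ?_, (j, i), ?_, ?_⟩, hc⟩
  · rw [← e.transpose_transpose, h, f.transpose_transpose]
  · cases e <;> exact he
  · cases f <;> exact hf

theorem SepStep.transpose {n : ℕ} {col : Edge n → Bool} {u v : LVertex n}
    (h : SepStep (col ∘ Edge.transpose) u v) : SepStep col u.swap v.swap := by
  obtain ⟨⟨⟨i, j⟩, b⟩, he, hs⟩ := h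
  refine ⟨((j, i), b), ?_, ?_⟩
  · cases b <;> simp only [StepOnEdge, lEdgeEnds, Prod.ext_iff, Prod.fst_swap, Prod.snd_swap]
      at he ⊢ <;> tauto
  · cases b <;> simp only [Separates, leftE, rightE, botE, topE, Function.comp, Edge.transpose]
      at hs ⊢ <;> grind

theorem transpose_comp_transpose {n : ℕ} (col : Edge n → Bool) :
    (col ∘ Edge.transpose) ∘ Edge.transpose = col :=
  funext fun e => congrArg col e.transpose_transpose

theorem HorizBridge.transpose {n : ℕ} {col : Edge n → Bool} {g : Bool}
    (h : HorizBridge (col ∘ Edge.transpose) g) : VertBridge col g := by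
  obtain ⟨j, j', hg, hr⟩ := h
  refine ⟨j', j, (col_eq_of_reflTransGen hr).symm.trans hg, ?_⟩
  exact reflTransGen_symm (fun _ _ => MonoStep.symm)
    (Relation.ReflTransGen.lift Edge.transpose (fun _ _ => MonoStep.transpose) _ _ hr)

theorem VertBridge.transpose {n : ℕ} {col : Edge n → Bool} {g : Bool}
    (h : VertBridge (col ∘ Edge.transpose) g) : HorizBridge col g := by
  obtain ⟨j, j', hg, hr⟩ := h
  refine ⟨j', j, (col_eq_of_reflTransGen hr).symm.trans hg, ?_⟩
  exact reflTransGen_symm (fun _ _ => MonoStep.symm)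
    (Relation.ReflTransGen.lift Edge.transpose (fun _ _ => MonoStep.transpose) _ _ hr)

theorem VertFault.transpose {n : ℕ} {col : Edge n → Bool}
    (h : VertFault (col ∘ Edge.transpose)) : HorizFault col := by
  obtain ⟨u, v, hu, hv, hr⟩ := h
  refine ⟨v.swap, u.swap, hv, hu, ?_⟩
  exact reflTransGen_symm (fun _ _ => SepStep.symm)
    (Relation.ReflTransGen.lift Prod.swap (fun _ _ => SepStep.transpose) _ _ hr)

theorem HorizFault.transpose {n : ℕ} {col : Edge n → Bool}
    (h : HorizFault (col ∘ Edge.transpose)) : VertFault col := by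
  obtain ⟨u, v, hu, hv, hr⟩ := h
  refine ⟨v.swap, u.swap, hv, hu, ?_⟩
  exact reflTransGen_symm (fun _ _ => SepStep.symm)
    (Relation.ReflTransGen.lift Prod.swap (fun _ _ => SepStep.transpose) _ _ hr)

/-! ### Existence of a bridge or a fault line -/

theorem sum_succ_sub_castSucc {n : ℕ} (f : Fin (n + 1) → ZMod 2) :
    ∑ i : Fin n, (f i.succ - f i.castSucc) = f (Fin.last n) - f 0 := by
  have h := (Fin.sum_univ_succ f).symm.trans (Fin.sum_univ_castSucc f)
  rw [Finset.sum_sub_distrib]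
  linear_combination h

/-- The pairing modulo 2 of an edge set with a set of `L_n`-vertices vanishes only if their
boundary values are compatible. -/
theorem no_local_pairing {n : ℕ} (s : Edge n → ZMod 2) (t : LVertex n → ZMod 2)
    (hl : ∀ j, s (Edge.horiz 0 j) = 1) (hr : ∀ j, s (Edge.horiz (Fin.last n) j) = 0)
    (ht : ∀ i, t (i, Fin.last n) = 1) (hb : ∀ i, t (i, 0) = 0) :
    ¬ ∀ i j : Fin n,
      (s (topE i j) - s (rightE i j)) * t (i.succ, j.succ) +
      (s (rightE i j) - s (botE i j)) * t (i.succ, j.castSucc) +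
      (s (botE i j) - s (leftE i j)) * t (i.castSucc, j.castSucc) +
      (s (leftE i j) - s (topE i j)) * t (i.castSucc, j.succ) = 0 := by
  intro h
  let A (k : Fin (n + 1)) (j : Fin n) : ZMod 2 :=
    s (Edge.horiz k j) * (t (k, j.succ) - t (k, j.castSucc))
  let B (i : Fin n) (k : Fin (n + 1)) : ZMod 2 :=
    s (Edge.vert i k) * (t (i.succ, k) - t (i.castSucc, k))
  have h1 : ∀ i j : Fin n,
      (A i.succ j - A i.castSucc j) = (B i j.succ - B i j.castSucc) := by
    intro i j
    have := h i j
    simp only [leftE, rightE, botE, topE] at this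
    simp only [A, B]
    linear_combination -this
  have h2 : ∑ j : Fin n, ∑ i : Fin n, (A i.succ j - A i.castSucc j) =
      ∑ i : Fin n, ∑ j : Fin n, (B i j.succ - B i j.castSucc) := by
    rw [Finset.sum_comm]
    exact Finset.sum_congr rfl fun i _ => Finset.sum_congr rfl fun j _ => h1 i j
  have h3 : ∀ j, ∑ i : Fin n, (A i.succ j - A i.castSucc j) =
      t (0, j.castSucc) - t (0, j.succ) := by
    intro j
    rw [sum_succ_sub_castSucc fun k => A k j]
    simp [A, hl, hr]
  have h4 : ∀ i, ∑ j : Fin n, (B i j.succ - B i j.castSucc) = 0 := by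
    intro i
    rw [sum_succ_sub_castSucc fun k => B i k]
    simp [B, ht, hb]
  simp only [h3, h4, Finset.sum_const_zero] at h2
  have h5 := sum_succ_sub_castSucc fun k : Fin (n + 1) => t (0, k)
  rw [Finset.sum_sub_distrib] at h2 h5
  have h6 : (1 : ZMod 2) = 0 := by
    linear_combination -h2 - h5 + hb 0 - ht 0
  exact absurd h6 (by decide)

theorem DiagonalRule.vertFault_or_horizBridge {n : ℕ} {col : Edge n → Bool}
    (hcol : DiagonalRule col) : VertFault col ∨ ∃ g, HorizBridge col g := by
  classical
  by_contra! hcon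
  obtain ⟨hf, hb⟩ := hcon
  let S (e : Edge n) : Prop := ∃ j, Relation.ReflTransGen (MonoStep col) (Edge.horiz 0 j) e
  let T (v : LVertex n) : Prop := ∃ u : LVertex n, u.2 = Fin.last n ∧
    Relation.ReflTransGen (SepStep col) u v
  have hS : ∀ e f : Edge n, ∀ v, EdgeIncident e v → EdgeIncident f v → col e = col f →
      (S e ↔ S f) := fun e f v he hf h =>
    ⟨fun ⟨j, hj⟩ => ⟨j, hj.trans (MonoStep.reflTransGen_of_incident he hf h)⟩,
      fun ⟨j, hj⟩ => ⟨j, hj.trans (MonoStep.reflTransGen_of_incident hf he h.symm)⟩⟩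
  have hT : ∀ u v, SepStep col u v → (T u ↔ T v) := fun u v h =>
    ⟨fun ⟨w, hw, hj⟩ => ⟨w, hw, hj.tail h⟩, fun ⟨w, hw, hj⟩ => ⟨w, hw, hj.tail h.symm⟩⟩
  refine no_local_pairing (fun e => if S e then 1 else 0) (fun v => if T v then 1 else 0)
    ?_ ?_ ?_ ?_ ?_
  · exact fun j => if_pos ⟨j, .refl⟩
  · exact fun j' => if_neg fun ⟨j, hj⟩ => hb _ ⟨j, j', rfl, hj⟩
  · exact fun i => if_pos ⟨_, rfl, .refl⟩
  · exact fun i => if_neg fun ⟨u, hu, hj⟩ => hf ⟨u, _, hu, rfl, hj⟩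
  · intro i j
    have key : ∀ e f, e ∈ ({leftE i j, rightE i j, botE i j, topE i j} : Set (Edge n)) →
        f ∈ ({leftE i j, rightE i j, botE i j, topE i j} : Set (Edge n)) → col e = col f →
        (S e ↔ S f) := fun e f he hf =>
      hS e f (i, j) (edgeIncident_iff.2 he) (edgeIncident_iff.2 hf)
    rcases hcol i j with ⟨h1, h2, h3⟩ | ⟨h1, h2, h3⟩ | ⟨h1, h2, h3⟩
    · simp only [← key _ _ (by simp) (by simp) h1, ← key _ _ (by simp) (by simp) h2,
        ← key _ _ (by simp) (by simp) h3]
      ring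
    · have := hT _ _ ⟨((i, j), true), Or.inl rfl, h1, h2, h3⟩
      simp only [← key _ _ (by simp) (by simp) h1, ← key _ _ (by simp) (by simp) h2, ← this]
      ring
    · have := hT _ _ ⟨((i, j), false), Or.inl rfl, h1, h2, h3⟩
      simp only [← key _ _ (by simp) (by simp) h1, ← key _ _ (by simp) (by simp) h2, ← this]
      ring

theorem DiagonalRule.horizFault_or_vertBridge {n : ℕ} {col : Edge n → Bool}
    (hcol : DiagonalRule col) : HorizFault col ∨ ∃ g, VertBridge col g :=
  hcol.transpose.vertFault_or_horizBridge.imp VertFault.transpose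
    fun ⟨g, h⟩ => ⟨g, h.transpose⟩

/-! ### Dual paths obstruct bridges -/

/-- A unit step between two `L_n`-vertices across an edge of colour `c`. -/
inductive DualStep {n : ℕ} (col : Edge n → Bool) (c : Bool) : LVertex n → LVertex n → Prop
  | up (k : Fin (n + 1)) (j : Fin n) (h : col (Edge.horiz k j) = c) :
      DualStep col c (k, j.castSucc) (k, j.succ)
  | down (k : Fin (n + 1)) (j : Fin n) (h : col (Edge.horiz k j) = c) :
      DualStep col c (k, j.succ) (k, j.castSucc)
  | right (i : Fin n) (k : Fin (n + 1)) (h : col (Edge.vert i k) = c) :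
      DualStep col c (i.castSucc, k) (i.succ, k)
  | left (i : Fin n) (k : Fin (n + 1)) (h : col (Edge.vert i k) = c) :
      DualStep col c (i.succ, k) (i.castSucc, k)

theorem DualStep.symm {n : ℕ} {col : Edge n → Bool} {c : Bool} {u v : LVertex n}
    (h : DualStep col c u v) : DualStep col c v u := by
  cases h with
  | up k j h => exact .down k j h
  | down k j h => exact .up k j h
  | right i k h => exact .left i k h
  | left i k h => exact .right i k h

/-- Counting the signed crossings of a dual path with horizontal rays. -/
theorem exists_crossing_function {n : ℕ} {col : Edge n → Bool} {c : Bool} {u v : LVertex n}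
    (h : Relation.ReflTransGen (DualStep col c) u v) :
    ∃ S : ℕ → ℕ → ℤ, (∀ j, S 0 j = 0) ∧
      (∀ (k : Fin (n + 1)) (j : Fin n), col (Edge.horiz k j) ≠ c → S (k + 1) j = S k j) ∧
      (∀ (i : Fin n) (k : Fin (n + 1)) (j : ℕ), col (Edge.vert i k) ≠ c → k.val = j + 1 →
        S (i + 1) j - S (i + 1) (j + 1) =
          (if v.2.val = j + 1 ∧ v.1 ≤ i.val then 1 else 0) -
          (if u.2.val = j + 1 ∧ u.1 ≤ i.val then 1 else 0)) ∧
      (∀ j : ℕ, S (n + 1) j =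
        (if u.2.val ≤ j then 1 else 0) - (if v.2.val ≤ j then 1 else 0)) := by
  induction h with
  | refl => exact ⟨fun _ _ => 0, by simp⟩
  | tail _ h ih =>
    obtain ⟨S, h0, h1, h2, h3⟩ := ih
    cases h with
    | up k j hc =>
      refine ⟨fun m l => S m l + if l = j.val ∧ k.val < m then 1 else 0, ?_, ?_, ?_, ?_⟩
      · intro l
        simp [h0]
      · intro k' j' hc'
        have := h1 k' j' hc'
        have : ¬ (k' = k ∧ j' = j) := by rintro ⟨rfl, rfl⟩; exact hc' hc
        simp only [Fin.ext_iff] at this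
        beta_reduce
        split_ifs <;> omega
      · intro i k' l hc' hk'
        have := h2 i k' l hc' hk'
        simp only [Fin.val_castSucc, Fin.val_succ] at this ⊢
        split_ifs at this ⊢ <;> omega
      · intro l
        have := h3 l
        have := k.isLt
        simp only [Fin.val_castSucc, Fin.val_succ] at *
        split_ifs at * <;> omega
    | down k j hc =>
      refine ⟨fun m l => S m l - if l = j.val ∧ k.val < m then 1 else 0, ?_, ?_, ?_, ?_⟩
      · intro l
        simp [h0]
      · intro k' j' hc'
        have := h1 k' j' hc'
        have : ¬ (k' = k ∧ j' = j) := by rintro ⟨rfl, rfl⟩; exact hc' hc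
        simp only [Fin.ext_iff] at this
        beta_reduce
        split_ifs <;> omega
      · intro i k' l hc' hk'
        have := h2 i k' l hc' hk'
        simp only [Fin.val_castSucc, Fin.val_succ] at this ⊢
        split_ifs at this ⊢ <;> omega
      · intro l
        have := h3 l
        have := k.isLt
        simp only [Fin.val_castSucc, Fin.val_succ] at *
        split_ifs at * <;> omega
    | right i k hc =>
      refine ⟨S, h0, h1, fun i' k' l hc' hk' => ?_, h3⟩
      have := h2 i' k' l hc' hk'
      have : ¬ (i' = i ∧ k' = k) := by rintro ⟨rfl, rfl⟩; exact hc' hc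
      simp only [Fin.ext_iff] at this
      simp only [Fin.val_castSucc, Fin.val_succ] at *
      split_ifs at * <;> omega
    | left i k hc =>
      refine ⟨S, h0, h1, fun i' k' l hc' hk' => ?_, h3⟩
      have := h2 i' k' l hc' hk'
      have : ¬ (i' = i ∧ k' = k) := by rintro ⟨rfl, rfl⟩; exact hc' hc
      simp only [Fin.ext_iff] at this
      simp only [Fin.val_castSucc, Fin.val_succ] at *
      split_ifs at * <;> omega

theorem HorizBridge.not_dualPath {n : ℕ} {col : Edge n → Bool} {g c : Bool} (hn : 1 ≤ n)
    (hgc : g ≠ c) (hb : HorizBridge col g) {u v : LVertex n} (hu : u.2 = Fin.last n)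
    (hv : v.2 = 0) : ¬ Relation.ReflTransGen (DualStep col c) u v := by
  intro h
  obtain ⟨S, h0, h1, h2, h3⟩ := exists_crossing_function h
  obtain ⟨j, j', hg, hr⟩ := hb
  have key : ∀ f, Relation.ReflTransGen (MonoStep col) (Edge.horiz 0 j) f →
      ∀ w : Fin n × Fin n, EdgeIncident f w → S (w.1 + 1) w.2 = 0 := by
    intro f hf
    induction hf with
    | refl =>
      rintro ⟨i, l⟩ ⟨rfl, hw⟩
      have hi : i.val = 0 := by
        simp only [Fin.ext_iff, Fin.val_castSucc, Fin.val_succ, Fin.val_zero] at hw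
        omega
      have := h1 0 j (hg ▸ hgc)
      simpa [hi, h0] using this
    | @tail e f he hef ih =>
      have hfc : col f ≠ c := by
        rw [← hef.2, ← col_eq_of_reflTransGen he, hg]
        exact hgc
      obtain ⟨⟨-, ⟨i, l⟩, hei, hfi⟩, -⟩ := hef
      have hz : S (i + 1) l = 0 := ih (i, l) hei
      rintro ⟨i', l'⟩ hfi'
      cases f with
      | horiz k m =>
        have := h1 k m hfc
        simp only [EdgeIncident, Fin.ext_iff, Fin.val_castSucc, Fin.val_succ] at hfi hfi' ⊢
        rw [← hfi.1] at hz
        rw [← hfi'.1]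
        grind
      | vert k m =>
        simp only [EdgeIncident, Fin.ext_iff, Fin.val_castSucc, Fin.val_succ] at hfi hfi' ⊢
        rw [← hfi.1] at hz
        rw [← hfi'.1]
        by_cases hm : l.val = l'.val
        · rwa [← hm]
        · have := h2 k m (m - 1) hfc (by omega)
          rw [if_neg (by simp [hv]), if_neg (by simp [hu]; omega)] at this
          grind
  have hlast : col (Edge.horiz (Fin.last n) j') ≠ c := by
    rw [← col_eq_of_reflTransGen hr, hg]
    exact hgc
  have e1 := key _ hr (⟨n - 1, by omega⟩, j') ⟨rfl, Or.inr (by simp [Fin.ext_iff]; omega)⟩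
  have e2 := h1 _ _ hlast
  have e3 := h3 j'
  rw [if_neg (by simp [hu]), if_pos (by simp [hv])] at e3
  simp only [Fin.val_last, Nat.sub_add_cancel hn] at e1 e2
  omega

theorem SepStep.dualPath {n : ℕ} {col : Edge n → Bool} (c : Bool) {u v : LVertex n}
    (h : SepStep col u v) : Relation.ReflTransGen (DualStep col c) u v := by
  have hsymm : ∀ a b, DualStep col c a b → DualStep col c b a := fun _ _ => DualStep.symm
  obtain ⟨e, he, hs⟩ := h
  have key : Relation.ReflTransGen (DualStep col c) (lEdgeEnds e).1 (lEdgeEnds e).2 := by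
    obtain ⟨⟨i, j⟩, _ | _⟩ := e <;> obtain ⟨h1, h2, h3⟩ := hs
    · by_cases hc : col (leftE i j) = c
      · exact .tail (.single (.left i j.castSucc (h1 ▸ hc))) (.up i.castSucc j hc)
      · have hc' : col (rightE i j) = c := by
          revert h3 hc; cases col (leftE i j) <;> cases col (rightE i j) <;> cases c <;> decide
        exact .tail (.single (.up i.succ j hc')) (.left i j.succ (h2 ▸ hc'))
    · by_cases hc : col (leftE i j) = c
      · exact .tail (.single (.up i.castSucc j hc)) (.right i j.succ (h1 ▸ hc))
      · have hc' : col (rightE i j) = c := by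
          revert h3 hc; cases col (leftE i j) <;> cases col (rightE i j) <;> cases c <;> decide
        exact .tail (.single (.right i j.castSucc (h2 ▸ hc'))) (.up i.succ j hc')
  rcases he with he | he
  · simpa [he] using key
  · simpa [he] using reflTransGen_symm hsymm key

/-- The lower or left `L_n`-vertex next to an edge. -/
def Edge.lowerFace {n : ℕ} : Edge n → LVertex n
  | Edge.horiz k j => (k, j.castSucc)
  | Edge.vert i k => (i.castSucc, k)

theorem DiagonalRule.dualPath_lowerFace {n : ℕ} {col : Edge n → Bool} (hcol : DiagonalRule col)
    {c : Bool} {e f : Edge n} (hc : col e = c) (h : MonoStep col e f) :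
    Relation.ReflTransGen (DualStep col c) e.lowerFace f.lowerFace := by
  have hsymm : ∀ a b, DualStep col c a b → DualStep col c b a := fun _ _ => DualStep.symm
  obtain ⟨⟨hne, ⟨i, j⟩, he, hf⟩, hef⟩ := h
  replace hef := hef.symm.trans hc
  have sy {a b : LVertex n} (h : Relation.ReflTransGen (DualStep col c) a b) :=
    reflTransGen_symm hsymm h
  have hl (h : col (leftE i j) = c) : Relation.ReflTransGen (DualStep col c)
    (leftE i j).lowerFace (topE i j).lowerFace := .single (.up i.castSucc j h)
  have hb (h : col (botE i j) = c) : Relation.ReflTransGen (DualStep col c)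
    (leftE i j).lowerFace (rightE i j).lowerFace := .single (.right i j.castSucc h)
  have hrt (hr : col (rightE i j) = c) (ht : col (topE i j) = c) :
    Relation.ReflTransGen (DualStep col c) (rightE i j).lowerFace (topE i j).lowerFace :=
    .tail (.single (.up i.succ j hr)) (.left i j.succ ht)
  have hij := hcol i j
  rcases edgeIncident_iff.1 he with rfl | rfl | rfl | rfl <;>
    rcases edgeIncident_iff.1 hf with rfl | rfl | rfl | rfl <;>
    first
    | exact .refl
    | exact hl (by grind)
    | exact sy (hl (by grind))
    | exact hb (by grind)
    | exact sy (hb (by grind))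
    | exact hrt (by grind) (by grind)
    | exact sy (hrt (by grind) (by grind))

theorem HorizBridge.not_vertFault {n : ℕ} {col : Edge n → Bool} {g : Bool} (hn : 1 ≤ n)
    (hb : HorizBridge col g) : ¬ VertFault col := by
  rintro ⟨u, v, hu, hv, h⟩
  have key : ∀ w, Relation.ReflTransGen (SepStep col) u w →
      Relation.ReflTransGen (DualStep col !g) u w := by
    intro w hw
    induction hw with
    | refl => exact .refl
    | tail _ h ih => exact ih.trans (h.dualPath _)
  exact hb.not_dualPath hn (by simp) hu hv (key v h)

theorem VertBridge.not_horizFault {n : ℕ} {col : Edge n → Bool} {g : Bool} (hn : 1 ≤ n)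
    (hb : VertBridge col g) : ¬ HorizFault col := by
  rw [← transpose_comp_transpose col] at hb ⊢
  exact fun h => hb.transpose.not_vertFault hn h.transpose

theorem DiagonalRule.eq_of_bridges {n : ℕ} {col : Edge n → Bool} (hcol : DiagonalRule col)
    (hn : 1 ≤ n) {g c : Bool} (hh : HorizBridge col g) (hv : VertBridge col c) : g = c := by
  by_contra hgc
  obtain ⟨i, i', hc, hr⟩ := hv
  have key : ∀ f, Relation.ReflTransGen (MonoStep col) (Edge.vert i (Fin.last n)) f →
      Relation.ReflTransGen (DualStep col c)
        (Edge.vert i (Fin.last n)).lowerFace f.lowerFace := by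
    intro f hf
    induction hf with
    | refl => exact .refl
    | tail he h ih =>
      exact ih.trans (hcol.dualPath_lowerFace ((col_eq_of_reflTransGen he).symm.trans hc) h)
  exact hh.not_dualPath hn hgc rfl rfl (key _ hr)

/-- `Ω = C_G ∪ C_FL ∪ C_R` is a partition of the state space. -/
theorem partition_of_state_space (n : ℕ) (hn : 1 ≤ n) :
    CG n ∪ CFL n ∪ CR n = OmegaSet n ∧
      CG n ∩ CFL n = ∅ ∧ CG n ∩ CR n = ∅ ∧ CFL n ∩ CR n = ∅ := by
  have hCG (τ : EdgeConfig n) : τ ∈ CG n ↔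
      IceRule τ ∧ HorizBridge (greenB τ) true ∧ VertBridge (greenB τ) true := by
    rw [← exists_isHorizBridge_iff, ← exists_isVertBridge_iff]
    rfl
  have hCR (τ : EdgeConfig n) : τ ∈ CR n ↔
      IceRule τ ∧ HorizBridge (greenB τ) false ∧ VertBridge (greenB τ) false := by
    rw [← exists_isHorizBridge_iff, ← exists_isVertBridge_iff]
    rfl
  have hCFL (τ : EdgeConfig n) : τ ∈ CFL n ↔
      IceRule τ ∧ (HorizFault (greenB τ) ∨ VertFault (greenB τ)) := by
    rw [← hasHorizFaultLine_iff, ← hasVertFaultLine_iff]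
    rfl
  refine ⟨?_, ?_, ?_, ?_⟩
  · ext τ
    simp only [Set.mem_union, hCG, hCR, hCFL]
    change _ ↔ IceRule τ
    refine ⟨by tauto, fun h => ?_⟩
    have hd := h.diagonalRule
    rcases hd.vertFault_or_horizBridge with h1 | ⟨g, h1⟩
    · exact .inl (.inr ⟨h, .inr h1⟩)
    rcases hd.horizFault_or_vertBridge with h2 | ⟨c, h2⟩
    · exact .inl (.inr ⟨h, .inl h2⟩)
    obtain rfl := hd.eq_of_bridges hn h1 h2
    cases g
    · exact .inr ⟨h, h1, h2⟩
    · exact .inl (.inl ⟨h, h1, h2⟩)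
  · refine Set.eq_empty_of_forall_notMem fun τ ⟨h1, h2⟩ => ?_
    obtain ⟨-, hh, hv⟩ := (hCG τ).1 h1
    exact ((hCFL τ).1 h2).2.elim (hv.not_horizFault hn) (hh.not_vertFault hn)
  · refine Set.eq_empty_of_forall_notMem fun τ ⟨h1, h2⟩ => ?_
    obtain ⟨hi, hh, -⟩ := (hCG τ).1 h1
    obtain ⟨-, -, hv⟩ := (hCR τ).1 h2
    exact Bool.noConfusion (hi.diagonalRule.eq_of_bridges hn hh hv)
  · refine Set.eq_empty_of_forall_notMem fun τ ⟨h2, h1⟩ => ?_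
    obtain ⟨-, hh, hv⟩ := (hCR τ).1 h1
    exact ((hCFL τ).1 h2).2.elim (hv.not_horizFault hn) (hh.not_vertFault hn)
end

section
/- Suppose τ ∈ C_G and τ' ∈ C_R, and τ' is obtained from τ by a single Glauber move flipping the four edges along a unit square s of ℤ². Then the four edges along s are all green in τ and all red in τ'; moreover, every green cross in τ must contain edges along s, and every red cross in τ' must contain edges along s. -/
open Finset

/-- A property propagates from the first to the last element of a chain, when each step may use
that both its ends satisfy `Q`. -/
theorem List.IsChain.propagate {α : Type*} {R : α → α → Prop} {Q S : α → Prop}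
    (hstep : ∀ x y, R x y → Q x → Q y → S x → S y) {p : List α} (hp : p.IsChain R)
    (hQ : ∀ x ∈ p, Q x) {a b : α} (ha : p.head? = some a) (hb : p.getLast? = some b)
    (hS : S a) : S b := by
  induction p generalizing a with
  | nil => simp at ha
  | cons x l ih =>
    obtain rfl : x = a := by simpa using ha
    cases l with
    | nil =>
      obtain rfl : x = b := by simpa using hb
      exact hS
    | cons y l =>
      rw [List.isChain_cons_cons] at hp
      exact ih hp.2 (fun z hz => hQ z (List.mem_cons_of_mem _ hz)) rfl
        (by simpa [List.getLast?_cons_cons] using hb)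
        (hstep x y hp.1 (hQ x (by simp)) (hQ y (by simp)) hS)

/-- In an Eulerian orientation, every vertex has as many green horizontal as green vertical
edges. -/
theorem IceRule.green_balance {n : ℕ} {τ : EdgeConfig n} (h : IceRule τ) (i j : Fin n) :
    (greenB τ (leftE i j)).toNat + (greenB τ (rightE i j)).toNat =
      (greenB τ (botE i j)).toNat + (greenB τ (topE i j)).toNat := by
  have h := h i j
  rcases Nat.mod_two_eq_zero_or_one (i.val + j.val) with h0 | h0
  · have h1 : (i.val + 1 + j.val) % 2 = 1 := by omega
    have h2 : (i.val + (j.val + 1)) % 2 = 1 := by omega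
    simp only [inDegree, greenB, leftE, rightE, botE, topE, greenOrient, Fin.val_castSucc,
      Fin.val_succ, h0, h1, h2] at h ⊢
    revert h
    cases τ (.horiz i.castSucc j) <;> cases τ (.horiz i.succ j) <;>
      cases τ (.vert i j.castSucc) <;> cases τ (.vert i j.succ) <;> decide
  · have h1 : (i.val + 1 + j.val) % 2 = 0 := by omega
    have h2 : (i.val + (j.val + 1)) % 2 = 0 := by omega
    simp only [inDegree, greenB, leftE, rightE, botE, topE, greenOrient, Fin.val_castSucc,
      Fin.val_succ, h0, h1, h2] at h ⊢
    revert h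
    cases τ (.horiz i.castSucc j) <;> cases τ (.horiz i.succ j) <;>
      cases τ (.vert i j.castSucc) <;> cases τ (.vert i j.succ) <;> decide

/-- The degree modulo 2 of the vertex `v` in the chain `c`. -/
def chainDegree {n : ℕ} (c : Edge n → ZMod 2) (v : Fin n × Fin n) : ZMod 2 :=
  c (leftE v.1 v.2) + c (rightE v.1 v.2) + c (botE v.1 v.2) + c (topE v.1 v.2)

/-- A mod 2 chain of green edges that avoids the top and bottom boundary and meets the left
boundary only in the edge at height `j₀`. -/
structure IsGreenChain {n : ℕ} (τ : EdgeConfig n) (j₀ : Fin n) (c : Edge n → ZMod 2) : Prop where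
  green : ∀ e, greenB τ e = false → c e = 0
  bottom : ∀ i, c (.vert i 0) = 0
  top : ∀ i, c (.vert i (Fin.last n)) = 0
  left : ∀ j, c (.horiz 0 j) = if j = j₀ then 1 else 0

theorem chainDegree_add_single {n : ℕ} (c : Edge n → ZMod 2) (e : Edge n) (v : Fin n × Fin n)
    [Decidable (EdgeIncident e v)] :
    chainDegree (c + Pi.single e 1) v = chainDegree c v + if EdgeIncident e v then 1 else 0 := by
  obtain ⟨i, j⟩ := v
  have hne (a : Fin n) : a.succ ≠ a.castSucc := Fin.castSucc_lt_succ.ne'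
  cases e with
  | horiz k l =>
    by_cases hl : l = j
    · subst hl
      by_cases h1 : k = i.castSucc
      · subst h1
        simp [chainDegree, EdgeIncident, leftE, rightE, botE, topE, hne]
        ring
      · by_cases h2 : k = i.succ
        · subst h2
          simp [chainDegree, EdgeIncident, leftE, rightE, botE, topE, (hne i).symm]
          ring
        · simp [chainDegree, EdgeIncident, leftE, rightE, botE, topE, h1, h2,
            Ne.symm h1, Ne.symm h2]
    · simp [chainDegree, EdgeIncident, leftE, rightE, botE, topE, hl, Ne.symm hl]
  | vert l k =>
    by_cases hl : l = i
    · subst hl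
      by_cases h1 : k = j.castSucc
      · subst h1
        simp [chainDegree, EdgeIncident, leftE, rightE, botE, topE, hne]
        ring
      · by_cases h2 : k = j.succ
        · subst h2
          simp [chainDegree, EdgeIncident, leftE, rightE, botE, topE, (hne j).symm]
          ring
        · simp [chainDegree, EdgeIncident, leftE, rightE, botE, topE, h1, h2,
            Ne.symm h1, Ne.symm h2]
    · simp [chainDegree, EdgeIncident, leftE, rightE, botE, topE, hl, Ne.symm hl]

theorem IsGreenChain.add_single {n : ℕ} {τ : EdgeConfig n} {j₀ : Fin n} {c : Edge n → ZMod 2}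
    (hc : IsGreenChain τ j₀ c) {e : Edge n} (he : greenB τ e = true)
    (hbot : ∀ i, e ≠ .vert i 0) (htop : ∀ i, e ≠ .vert i (Fin.last n))
    (hleft : ∀ j, e ≠ .horiz 0 j) : IsGreenChain τ j₀ (c + Pi.single e 1) where
  green f hf := by
    have : f ≠ e := by rintro rfl; simp [he] at hf
    simp [hc.green f hf, this]
  bottom i := by simp [hc.bottom, (hbot i).symm]
  top i := by simp [hc.top, (htop i).symm]
  left j := by simp [hc.left, (hleft j).symm]

/-- Boundary edges have a single incident vertex. -/
theorem EdgeIncident.not_boundary {n : ℕ} {e : Edge n} {v w : Fin n × Fin n}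
    (hv : EdgeIncident e v) (hw : EdgeIncident e w) (hvw : v ≠ w) :
    (∀ i, e ≠ .vert i 0) ∧ (∀ i, e ≠ .vert i (Fin.last n)) ∧ ∀ j, e ≠ .horiz 0 j := by
  obtain ⟨a, b⟩ := v
  obtain ⟨a', b'⟩ := w
  refine ⟨?_, ?_, ?_⟩ <;> rintro x rfl <;>
  · simp only [EdgeIncident, Fin.ext_iff, Fin.val_castSucc, Fin.val_succ, Fin.val_last,
      Fin.val_zero, ne_eq, Prod.mk.injEq] at hv hw hvw
    omega

/-- Two vertices incident to the same edge exhaust its incident vertices. -/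
theorem EdgeIncident.eq_or_eq {n : ℕ} {e : Edge n} {u v w : Fin n × Fin n}
    (hu : EdgeIncident e u) (hv : EdgeIncident e v) (hw : EdgeIncident e w) (hvw : v ≠ w) :
    u = v ∨ u = w := by
  obtain ⟨a, b⟩ := u
  obtain ⟨a', b'⟩ := v
  obtain ⟨a'', b''⟩ := w
  cases e <;>
  · simp only [EdgeIncident, Fin.ext_iff, Fin.val_castSucc, Fin.val_succ, ne_eq,
      Prod.mk.injEq] at hu hv hw hvw ⊢
    omega

/-- Some green chain, entering from the left boundary, ends at the vertex `v`. -/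
def GreenReaches {n : ℕ} (τ : EdgeConfig n) (j₀ : Fin n) (v : Fin n × Fin n) : Prop :=
  ∃ c, IsGreenChain τ j₀ c ∧ ∀ u, chainDegree c u = if u = v then 1 else 0

theorem GreenReaches.step {n : ℕ} {τ : EdgeConfig n} {j₀ : Fin n} {e : Edge n}
    {v w : Fin n × Fin n} (h : GreenReaches τ j₀ v) (he : greenB τ e = true)
    (hv : EdgeIncident e v) (hw : EdgeIncident e w) : GreenReaches τ j₀ w := by
  classical
  obtain rfl | hvw := eq_or_ne v w
  · exact h
  obtain ⟨c, hc, hd⟩ := h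
  obtain ⟨h1, h2, h3⟩ := hv.not_boundary hw hvw
  refine ⟨_, hc.add_single he h1 h2 h3, fun u => ?_⟩
  rw [chainDegree_add_single, hd]
  by_cases hu : EdgeIncident e u
  · obtain rfl | rfl := hu.eq_or_eq hv hw hvw
    · simp [hu, hvw, CharTwo.add_self_eq_zero]
    · simp [hu, hvw.symm]
  · have huv : u ≠ v := by rintro rfl; exact hu hv
    have huw : u ≠ w := by rintro rfl; exact hu hw
    simp [hu, huv, huw]

/-- A horizontal green bridge yields a relative mod 2 cycle of green edges that meets the left
boundary in a single edge and avoids the top and bottom boundary. -/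
theorem IsHorizBridge.exists_cycle {n : ℕ} {τ : EdgeConfig n} {p : List (Edge n)}
    (hp : IsHorizBridge τ true p) :
    ∃ j₀ c, IsGreenChain τ j₀ c ∧ ∀ u, chainDegree c u = 0 := by
  classical
  obtain ⟨⟨-, -, hchain, hgreen⟩, ⟨j₀, hhead⟩, ⟨j₁, hlast⟩⟩ := hp
  obtain ⟨m, rfl⟩ : ∃ m, n = m + 1 := ⟨n - 1, by have := j₀.isLt; omega⟩
  have hstart : ∀ v, EdgeIncident (.horiz 0 j₀) v → GreenReaches τ j₀ v := by
    intro v hv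
    have hinc (u) (hu : EdgeIncident (.horiz 0 j₀) u) : u = v := by
      by_contra huv
      exact (hu.not_boundary hv huv).2.2 j₀ rfl
    refine ⟨0 + Pi.single (.horiz 0 j₀) 1, ⟨fun e he => ?_, by simp, by simp, fun j => ?_⟩,
      fun u => ?_⟩
    · have : e ≠ .horiz 0 j₀ := by
        rintro rfl
        simp [hgreen _ (List.mem_of_mem_head? hhead)] at he
      simp [this]
    · simp [Pi.single_apply]
    · rw [chainDegree_add_single]
      by_cases hu : EdgeIncident (.horiz 0 j₀) u
      · simp [hinc u hu, hv, chainDegree]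
      · have : u ≠ v := by rintro rfl; exact hu hv
        simp [hu, this, chainDegree]
  have hend := List.IsChain.propagate (Q := fun e => greenB τ e = true)
    (S := fun e => ∀ v, EdgeIncident e v → GreenReaches τ j₀ v)
    (fun e f hef _ hf ih v hv => by
      obtain ⟨-, w, hew, hfw⟩ := hef
      exact (ih w hew).step hf hfw hv) hchain hgreen hhead hlast hstart
  obtain ⟨c, hc, hd⟩ := hend (Fin.last m, j₁) (by simp [EdgeIncident])
  refine ⟨j₀, _, hc.add_single (hgreen _ (List.mem_of_mem_getLast? hlast)) (by simp) (by simp)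
    (fun j h => ?_), fun u => ?_⟩
  · simp [Fin.ext_iff] at h
  · rw [chainDegree_add_single, hd]
    have : EdgeIncident (.horiz (Fin.last (m + 1)) j₁) u ↔ u = (Fin.last m, j₁) := by
      obtain ⟨a, b⟩ := u
      simp only [EdgeIncident, Fin.ext_iff, Fin.val_castSucc, Fin.val_succ, Fin.val_last,
        Prod.mk.injEq]
      omega
    by_cases hu : u = (Fin.last m, j₁)
    · rw [if_pos hu, if_pos (this.2 hu), CharTwo.add_self_eq_zero]
    · rw [if_neg hu, if_neg (mt this.1 hu), add_zero]

/-- The value at the face `(i, k)` of the potential of a mod 2 chain. -/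
def chainPotential {n : ℕ} (c : Edge n → ZMod 2) (i k : Fin (n + 1)) : ZMod 2 :=
  ∑ j : Fin n with j.castSucc < k, c (.horiz i j)

theorem chainPotential_zero {n : ℕ} (c : Edge n → ZMod 2) (i : Fin (n + 1)) :
    chainPotential c i 0 = 0 := by
  simp [chainPotential]

theorem chainPotential_last {n : ℕ} (c : Edge n → ZMod 2) (i : Fin (n + 1)) :
    chainPotential c i (Fin.last n) = ∑ j : Fin n, c (.horiz i j) := by
  simp [chainPotential, Fin.castSucc_lt_last]

theorem chainPotential_succ {n : ℕ} (c : Edge n → ZMod 2) (i : Fin (n + 1)) (j : Fin n) :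
    chainPotential c i j.succ = chainPotential c i j.castSucc + c (.horiz i j) := by
  have : (univ.filter fun l : Fin n => l.castSucc < j.succ) =
      insert j (univ.filter fun l : Fin n => l.castSucc < j.castSucc) := by
    ext l
    simp only [mem_filter, mem_univ, true_and, mem_insert, Fin.lt_def, Fin.ext_iff,
      Fin.val_castSucc, Fin.val_succ]
    omega
  rw [chainPotential, this, sum_insert (by simp), add_comm, chainPotential]

/-- The potential of a relative cycle changes across a vertical edge by the coefficient of that
edge. -/
theorem chainPotential_right {n : ℕ} {c : Edge n → ZMod 2} (hbot : ∀ i, c (.vert i 0) = 0)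
    (hd : ∀ u, chainDegree c u = 0) (i : Fin n) (k : Fin (n + 1)) :
    chainPotential c i.succ k = chainPotential c i.castSucc k + c (.vert i k) := by
  induction k using Fin.induction with
  | zero => simp [chainPotential_zero, hbot]
  | succ j ih =>
    have h := hd (i, j)
    simp only [chainDegree, leftE, rightE, botE, topE] at h
    rw [chainPotential_succ, chainPotential_succ, ih]
    generalize c (.horiz i.castSucc j) = x, c (.horiz i.succ j) = y, c (.vert i j.castSucc) = z,
      c (.vert i j.succ) = t at h ⊢
    have h2 : (2 : ZMod 2) = 0 := rfl
    linear_combination h + (-x - t) * h2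

/-- The two faces separated by an edge both have potential `1`. -/
def PotentialOneBeside {n : ℕ} (c : Edge n → ZMod 2) : Edge n → Prop
  | .horiz k j => chainPotential c k j.castSucc = 1 ∧ chainPotential c k j.succ = 1
  | .vert i k => chainPotential c i.castSucc k = 1 ∧ chainPotential c i.succ k = 1

/-- The potential of a green cycle is constant along red paths. -/
theorem PotentialOneBeside.step {n : ℕ} {τ : EdgeConfig n} (hτ : IceRule τ)
    {c : Edge n → ZMod 2} (hgreen : ∀ e, greenB τ e = false → c e = 0)
    (hbot : ∀ i, c (.vert i 0) = 0) (hd : ∀ u, chainDegree c u = 0) {e f : Edge n}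
    (hef : EdgeAdj e f) (he : greenB τ e = false) (hf : greenB τ f = false)
    (h : PotentialOneBeside c e) : PotentialOneBeside c f := by
  obtain ⟨hne, ⟨i, j⟩, hei, hfi⟩ := hef
  have hbal := hτ.green_balance i j
  have h1 := chainPotential_succ c i.castSucc j
  have h2 := chainPotential_succ c i.succ j
  have h3 := chainPotential_right hbot hd i j.castSucc
  have h4 := chainPotential_right hbot hd i j.succ
  have g1 := hgreen (leftE i j)
  have g2 := hgreen (rightE i j)
  have g3 := hgreen (botE i j)
  have g4 := hgreen (topE i j)
  have b1 : greenB τ (leftE i j) = false → greenB τ (rightE i j) = false →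
      greenB τ (botE i j) = false ∧ greenB τ (topE i j) = false := by
    intro ha hb
    simpa [ha, hb] using hbal.symm
  have b2 : greenB τ (botE i j) = false → greenB τ (topE i j) = false →
      greenB τ (leftE i j) = false ∧ greenB τ (rightE i j) = false := by
    intro ha hb
    simpa [ha, hb] using hbal
  clear hbal hgreen hbot hd hτ
  simp only [leftE, rightE, botE, topE] at b1 b2 g1 g2 g3 g4
  cases e <;> cases f <;> obtain ⟨rfl, rfl | rfl⟩ := hei <;> obtain ⟨rfl, rfl | rfl⟩ := hfi <;>
    simp only [PotentialOneBeside] at h ⊢ <;> grind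

/-- An Eulerian orientation cannot have both a horizontal green and a vertical red bridge. -/
theorem IceRule.not_horizGreenBridge_and_vertRedBridge {n : ℕ} {τ : EdgeConfig n}
    (hτ : IceRule τ) (hG : HorizGreenBridge τ) (hR : VertRedBridge τ) : False := by
  obtain ⟨p, hp⟩ := hG
  obtain ⟨j₀, c, hc, hd⟩ := hp.exists_cycle
  obtain ⟨q, ⟨-, -, hchain, hred⟩, ⟨i, hhead⟩, ⟨i', hlast⟩⟩ := hR
  have htop : ∀ k, chainPotential c k (Fin.last n) = 1 := by
    intro k
    induction k using Fin.induction with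
    | zero => simp [chainPotential_last, hc.left]
    | succ k ih => rw [chainPotential_right hc.bottom hd, ih, hc.top, add_zero]
  have hend := List.IsChain.propagate (Q := fun e => greenB τ e = false)
    (S := PotentialOneBeside c)
    (fun _ _ hef he hf => PotentialOneBeside.step hτ hc.green hc.bottom hd hef he hf)
    hchain hred hhead hlast ⟨htop _, htop _⟩
  have h01 := hend.1
  rw [chainPotential_zero] at h01
  exact zero_ne_one h01

theorem IceRule.not_crosses {n : ℕ} {τ : EdgeConfig n} (hτ : IceRule τ)
    (hG : HasGreenCross τ) (hR : HasRedCross τ) : False :=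
  hτ.not_horizGreenBridge_and_vertRedBridge hG.1 hR.2

theorem MonoPath.congr {n : ℕ} {τ τ' : EdgeConfig n} {g : Bool} {p : List (Edge n)}
    (hp : MonoPath τ g p) (h : ∀ e ∈ p, greenB τ e = g → greenB τ' e = g) : MonoPath τ' g p :=
  ⟨hp.1, hp.2.1, hp.2.2.1, fun e he => h e he (hp.2.2.2 e he)⟩

theorem greenB_flipSquare {n : ℕ} (τ : EdgeConfig n) (s : Edge n × Edge n × Edge n × Edge n)
    (f : Edge n) : greenB (flipSquare τ s) f =
      if f = s.1 ∨ f = s.2.1 ∨ f = s.2.2.1 ∨ f = s.2.2.2 then !(greenB τ f) else greenB τ f := by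
  unfold greenB flipSquare
  split_ifs
  · cases τ f <;> cases greenOrient f <;> rfl
  · rfl

/-- The edges of a consistently oriented unit square all have the same colour. -/
theorem DirectedSquare.monochromatic {n : ℕ} {τ : EdgeConfig n} {i j : ℕ} {hi : i + 1 < n}
    {hj : j + 1 < n} (h : DirectedSquare τ (squareEdges n i j hi hj)) :
    ∃ g, greenB τ (squareEdges n i j hi hj).1 = g ∧ greenB τ (squareEdges n i j hi hj).2.1 = g ∧
      greenB τ (squareEdges n i j hi hj).2.2.1 = g ∧
      greenB τ (squareEdges n i j hi hj).2.2.2 = g := by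
  refine ⟨_, rfl, ?_⟩
  rcases Nat.mod_two_eq_zero_or_one (i + j) with h0 | h0
  · have h1 : (i + 1 + j) % 2 = 1 := by omega
    have h2 : (i + (j + 1)) % 2 = 1 := by omega
    have h3 : (i + 1 + (j + 1)) % 2 = 0 := by omega
    rcases h with ⟨a, b, c, d⟩ | ⟨a, b, c, d⟩ <;> simp only [greenB, a, b, c, d] <;>
      simp [squareEdges, greenOrient, h1, h2, h3]
  · have h1 : (i + 1 + j) % 2 = 0 := by omega
    have h2 : (i + (j + 1)) % 2 = 0 := by omega
    have h3 : (i + 1 + (j + 1)) % 2 = 1 := by omega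
    rcases h with ⟨a, b, c, d⟩ | ⟨a, b, c, d⟩ <;> simp only [greenB, a, b, c, d] <;>
      simp [squareEdges, greenOrient, h1, h2, h3]

/-- if a single Glauber move at the unit square `s` takes
`τ ∈ C_G` to `τ' ∈ C_R`, then the four edges of `s` are all green in `τ` and
all red in `τ'`, and every green cross of `τ`, as well as every red cross of
`τ'`, contains an edge of `s`. -/
theorem move_from_CG_to_CR_square (n : ℕ) (hn : 1 ≤ n)
    (τ τ' : EdgeConfig n) (i j : ℕ) (hi : i + 1 < n) (hj : j + 1 < n)
    (hτ : τ ∈ CG n) (hτ' : τ' ∈ CR n)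
    (hmove : GlauberMoveAt τ τ' i j hi hj) :
    (greenB τ (squareEdges n i j hi hj).1 = true ∧
      greenB τ (squareEdges n i j hi hj).2.1 = true ∧
      greenB τ (squareEdges n i j hi hj).2.2.1 = true ∧
      greenB τ (squareEdges n i j hi hj).2.2.2 = true) ∧
    (greenB τ' (squareEdges n i j hi hj).1 = false ∧
      greenB τ' (squareEdges n i j hi hj).2.1 = false ∧
      greenB τ' (squareEdges n i j hi hj).2.2.1 = false ∧
      greenB τ' (squareEdges n i j hi hj).2.2.2 = false) ∧
    (∀ ph pv : List (Edge n), IsHorizBridge τ true ph → IsVertBridge τ true pv →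
      ∃ f : Edge n, (f = (squareEdges n i j hi hj).1 ∨
          f = (squareEdges n i j hi hj).2.1 ∨
          f = (squareEdges n i j hi hj).2.2.1 ∨
          f = (squareEdges n i j hi hj).2.2.2) ∧ (f ∈ ph ∨ f ∈ pv)) ∧
    (∀ ph pv : List (Edge n), IsHorizBridge τ' false ph → IsVertBridge τ' false pv →
      ∃ f : Edge n, (f = (squareEdges n i j hi hj).1 ∨
          f = (squareEdges n i j hi hj).2.1 ∨
          f = (squareEdges n i j hi hj).2.2.1 ∨
          f = (squareEdges n i j hi hj).2.2.2) ∧ (f ∈ ph ∨ f ∈ pv)) := by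
  obtain ⟨hdir, rfl⟩ := hmove
  obtain ⟨g, hg⟩ := hdir.monochromatic
  generalize squareEdges n i j hi hj = s at hdir hτ' hg ⊢
  obtain ⟨hice, ⟨gh, hgh⟩, ⟨gv, hgv⟩⟩ := hτ
  obtain ⟨hice', hred⟩ := hτ'
  have hflip := greenB_flipSquare τ s
  obtain rfl : g = true := by
    by_contra hgt
    have hmono (e) (he : greenB τ e = true) : greenB (flipSquare τ s) e = true := by grind
    exact hice'.not_crosses ⟨⟨gh, hgh.1.congr fun e _ => hmono e, hgh.2⟩,
      ⟨gv, hgv.1.congr fun e _ => hmono e, hgv.2⟩⟩ hred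
  refine ⟨hg, by simp [hflip, hg], fun ph pv hh hv => ?_, fun ph pv hh hv => ?_⟩
  · by_contra! hcon
    exact hice'.not_crosses ⟨⟨ph, hh.1.congr (by grind), hh.2⟩,
      ⟨pv, hv.1.congr (by grind), hv.2⟩⟩ hred
  · by_contra! hcon
    exact hice.not_crosses ⟨⟨gh, hgh⟩, ⟨gv, hgv⟩⟩ ⟨⟨ph, hh.1.congr (by grind), hh.2⟩,
      ⟨pv, hv.1.congr (by grind), hv.2⟩⟩
end

section
/- Let τ ∈ Ω and let s be a unit square of ℤ² inside Λ_n. If there exist both a simple green path and a simple red path in τ, each from a vertex on s to the top boundary of Λ_n, then there exists a path of L_τ-edges from an L_n-vertex adjacent to s to the top boundary of L_n. -/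
open Finset

/-- A Boolean sequence vanishing at `n` with prescribed increments below `n`. -/
theorem exists_bool_primitive (n : ℕ) (m : ℕ → Bool) :
    ∃ c : ℕ → Bool, c n = false ∧ ∀ k < n, c k = (m k ^^ c (k + 1)) := by
  refine ⟨fun k => Nat.rec (motive := fun _ => Bool) false
    (fun d acc => (m (n - 1 - d) ^^ acc)) (n - k), by simp, fun k hk => ?_⟩
  obtain ⟨d, rfl⟩ := Nat.exists_eq_add_of_lt hk
  have h1 : k + d + 1 - k = d + 1 := by omega
  have h2 : k + d + 1 - (k + 1) = d := by omega
  have h3 : k + d + 1 - 1 - d = k := by omega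
  simp only [h1, h2, h3]

/-- Local analysis at a vertex with edge colours `l`, `r`, `b`, `t` and marks `sw`, `se`, `nw`, `ne`
on the four surrounding `L_n`-vertices: the separating diagonal, if marked, is crossed exactly by
the pairs of adjacent edges of different colours. -/
theorem corner_identities (l r b t sw se nw ne : Bool)
    (mono : l = r → b = l ∧ t = l) (mixed : l ≠ r → b ≠ t)
    (diag : l = t → l ≠ r → sw = ne) (anti : l = b → l ≠ r → se = nw) :
    let m := (l ^^ r) && cond (l == t) sw se
    (m && (r ^^ t)) = (ne && (r ^^ t)) ∧ (m && (l ^^ t)) = (nw && (l ^^ t)) ∧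
      (m ^^ (m && (r ^^ t))) = (se && (r ^^ b)) ∧ (m ^^ (m && (l ^^ t))) = (sw && (l ^^ b)) ∧
      (m = true → l ≠ r) ∧ (m = false → sw = true → se = true → l = r) := by
  dsimp only
  revert mono mixed diag anti
  cases l <;> cases r <;> cases b <;> cases t <;> simp +contextual

/-- Around a face the marked colour changes add up to zero. -/
theorem glue_face {x y m m' u u' p d r t l : Bool} (h : (x ^^ u) = (y ^^ u'))
    (hl : (m ^^ u) = (p && (t ^^ l))) (hr : (m' ^^ u') = (p && (t ^^ r))) :
    ((m ^^ x) ^^ (p && (d ^^ l))) = ((m' ^^ y) ^^ (p && (d ^^ r))) := by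
  revert h hl hr
  cases p <;> revert x y m m' u u' d r t l <;> decide

/-- Let `H`, `V` colour the horizontal and vertical edges so that the ice rule holds, and let `P`
be a set of `L_n`-vertices which is a union of components of the separating diagonals and avoids
the top boundary.  There is a second colouring `cH`, `cV`, vanishing on the top boundary edges,
whose colour changes are exactly the ones across the separating diagonals lying in `P`. -/
theorem exists_colouring_of_components {n : ℕ} {H V P : ℕ → ℕ → Bool}
    (ice : ∀ i < n, ∀ j < n, (H i j = H (i + 1) j → V i j = H i j ∧ V i (j + 1) = H i j) ∧
      (H i j ≠ H (i + 1) j → V i j ≠ V i (j + 1)))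
    (diag : ∀ i < n, ∀ j < n, H i j = V i (j + 1) → H i j ≠ H (i + 1) j →
      P i j = P (i + 1) (j + 1))
    (anti : ∀ i < n, ∀ j < n, H i j = V i j → H i j ≠ H (i + 1) j →
      P (i + 1) j = P i (j + 1))
    (top : ∀ a ≤ n, P a n = false) :
    ∃ cH cV : ℕ → ℕ → Bool, (∀ i, cV i n = false) ∧
      ∀ i < n, ∀ j < n, ∃ b,
        (cH i j = b ∧ cH (i + 1) j = b ∧ cV i j = b ∧ cV i (j + 1) = b ∧
          (P i j = true → P (i + 1) j = true → H i j = H (i + 1) j)) ∨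
        ((cH i j ^^ H i j) = b ∧ (cH (i + 1) j ^^ H (i + 1) j) = b ∧
          (cV i j ^^ V i j) = b ∧ (cV i (j + 1) ^^ V i (j + 1)) = b) := by
  let m : ℕ → ℕ → Bool := fun i j =>
    (H i j ^^ H (i + 1) j) && cond (H i j == V i (j + 1)) (P i j) (P (i + 1) j)
  choose cV cVtop cVstep using fun i => exists_bool_primitive n (m i)
  let cL : ℕ → ℕ → Bool := fun i j => cV i (j + 1) ^^ (m i j && (H i j ^^ V i (j + 1)))
  let cR : ℕ → ℕ → Bool := fun i j => cV i (j + 1) ^^ (m i j && (H (i + 1) j ^^ V i (j + 1)))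
  have corner : ∀ i (hi : i < n) j (hj : j < n), _ := fun i hi j hj =>
    corner_identities _ _ _ _ _ _ _ _ (ice i hi j hj).1 (ice i hi j hj).2 (diag i hi j hj)
      (anti i hi j hj)
  have ne : ∀ i < n, ∀ j < n, (m i j && (H (i + 1) j ^^ V i (j + 1))) =
      (P (i + 1) (j + 1) && (H (i + 1) j ^^ V i (j + 1))) :=
    fun i hi j hj => (corner i hi j hj).1
  have nw : ∀ i < n, ∀ j < n, (m i j && (H i j ^^ V i (j + 1))) =
      (P i (j + 1) && (H i j ^^ V i (j + 1))) :=
    fun i hi j hj => (corner i hi j hj).2.1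
  have se : ∀ i < n, ∀ j < n, (m i j ^^ (m i j && (H (i + 1) j ^^ V i (j + 1)))) =
      (P (i + 1) j && (H (i + 1) j ^^ V i j)) :=
    fun i hi j hj => (corner i hi j hj).2.2.1
  have sw : ∀ i < n, ∀ j < n, (m i j ^^ (m i j && (H i j ^^ V i (j + 1)))) =
      (P i j && (H i j ^^ V i j)) :=
    fun i hi j hj => (corner i hi j hj).2.2.2.1
  have glue : ∀ i, i + 1 < n → ∀ d j, j + d + 1 = n → cR i j = cL (i + 1) j := by
    intro i hi d
    induction d with
    | zero =>
      rintro j rfl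
      simp only [cR, cL]
      rw [ne i (by omega) j (by omega), nw (i + 1) hi j (by omega), cVtop, cVtop,
        top _ (by omega)]
      simp
    | succ d ih =>
      intro j hj
      have h := ih (j + 1) (by omega)
      simp only [cR, cL] at h ⊢
      rw [ne i (by omega) j (by omega), nw (i + 1) hi j (by omega),
        cVstep i _ (by omega), cVstep (i + 1) _ (by omega)]
      have h1 := se i (by omega) (j + 1) (by omega)
      have h2 := sw (i + 1) (by omega) (j + 1) (by omega)
      exact glue_face h h1 h2
  let cH : ℕ → ℕ → Bool := fun i j => if i < n then cL i j else cR (i - 1) j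
  have hright : ∀ i < n, ∀ j < n, cH (i + 1) j = cR i j := by
    intro i hi j hj
    by_cases h : i + 1 < n
    · simp only [cH, h, if_true]
      exact (glue i h (n - j - 1) j (by omega)).symm
    · simp [cH, h]
  refine ⟨cH, cV, cVtop, fun i hi j hj => ?_⟩
  have hleft : cH i j = cL i j := by simp [cH, hi]
  rw [hright i hi j hj, hleft, cVstep i j hj]
  obtain ⟨-, -, -, -, hm1, hm0⟩ := corner i hi j hj
  change m i j = true → _ at hm1
  change m i j = false → _ at hm0
  cases hm : m i j
  · exact ⟨cV i (j + 1), Or.inl ⟨by simp [cL, hm], by simp [cR, hm], by simp, rfl, hm0 hm⟩⟩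
  · have hbt : (V i j ^^ V i (j + 1)) = true := by
      simpa [bne_iff_ne] using (ice i hi j hj).2 (hm1 hm)
    refine ⟨cV i (j + 1) ^^ V i (j + 1), Or.inr ⟨?_, ?_, ?_, rfl⟩⟩
    · simp only [cL, hm]
      cases cV i (j + 1) <;> cases H i j <;> cases V i (j + 1) <;> rfl
    · simp only [cR, hm]
      cases cV i (j + 1) <;> cases H (i + 1) j <;> cases V i (j + 1) <;> rfl
    · revert hbt
      cases cV i (j + 1) <;> cases V i j <;> cases V i (j + 1) <;> simp

/-- In terms of colours, the ice rule says that a vertex is either monochromatic or has one green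
and one red edge in each of the two directions. -/
theorem IceRule.green {n : ℕ} {τ : EdgeConfig n} (hτ : IceRule τ) (i j : Fin n) :
    (greenB τ (leftE i j) = greenB τ (rightE i j) →
        greenB τ (botE i j) = greenB τ (leftE i j) ∧
          greenB τ (topE i j) = greenB τ (leftE i j)) ∧
      (greenB τ (leftE i j) ≠ greenB τ (rightE i j) →
        greenB τ (botE i j) ≠ greenB τ (topE i j)) := by
  have h := hτ i j
  have hr : greenOrient (rightE i j) = !greenOrient (leftE i j) := by
    simp only [greenOrient, rightE, leftE, Fin.val_succ, Fin.val_castSucc]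
    grind
  have hb : greenOrient (botE i j) = !greenOrient (leftE i j) := by
    simp only [greenOrient, botE, leftE, Fin.val_castSucc]
    grind
  have ht : greenOrient (topE i j) = greenOrient (leftE i j) := by
    simp only [greenOrient, topE, leftE, Fin.val_succ, Fin.val_castSucc]
    grind
  simp only [inDegree, greenB, hr, hb, ht] at h ⊢
  revert h
  generalize greenOrient (leftE i j) = g
  generalize τ (leftE i j) = l
  generalize τ (rightE i j) = r
  generalize τ (botE i j) = b
  generalize τ (topE i j) = t
  revert g l r b t
  decide

/-- If a set `S` of `L_n`-vertices is closed under `L_τ`-steps and avoids the top boundary, then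
there is a colouring `c` of the edges, constant on the top boundary, which changes exactly across
the `L_τ`-edges inside `S`. -/
theorem exists_colouring_of_closed {n : ℕ} {τ : EdgeConfig n} (hτ : IceRule τ)
    {S : LVertex n → Prop} (hS : ∀ u v, LStep τ u v → S u → S v)
    (htop : ∀ u, S u → u.2 ≠ Fin.last n) :
    ∃ c : Edge n → Bool, (∀ i, c (Edge.vert i (Fin.last n)) = false) ∧ ∀ i j : Fin n,
      ((∃ b, ∀ e, EdgeIncident e (i, j) → c e = b) ∨
        ∃ b, ∀ e, EdgeIncident e (i, j) → (c e ^^ greenB τ e) = b) ∧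
      (S (i.castSucc, j.castSucc) → S (i.succ, j.castSucc) →
        ∃ b, ∀ e, EdgeIncident e (i, j) → (c e ^^ greenB τ e) = b) := by
  classical
  let H : ℕ → ℕ → Bool := fun k j =>
    if h : k < n + 1 ∧ j < n then greenB τ (.horiz ⟨k, h.1⟩ ⟨j, h.2⟩) else false
  let V : ℕ → ℕ → Bool := fun i k =>
    if h : i < n ∧ k < n + 1 then greenB τ (.vert ⟨i, h.1⟩ ⟨k, h.2⟩) else false
  let P : ℕ → ℕ → Bool := fun a b =>
    if h : a < n + 1 ∧ b < n + 1 then decide (S (⟨a, h.1⟩, ⟨b, h.2⟩)) else false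
  have hl : ∀ i j : Fin n, H i j = greenB τ (leftE i j) := fun i j =>
    dif_pos ⟨by omega, j.2⟩
  have hr : ∀ i j : Fin n, H (i + 1) j = greenB τ (rightE i j) := fun i j =>
    dif_pos ⟨by omega, j.2⟩
  have hb : ∀ i j : Fin n, V i j = greenB τ (botE i j) := fun i j =>
    dif_pos ⟨i.2, by omega⟩
  have ht : ∀ i j : Fin n, V i (j + 1) = greenB τ (topE i j) := fun i j =>
    dif_pos ⟨i.2, by omega⟩
  have hP : ∀ a b : Fin (n + 1), P a b = decide (S (a, b)) := fun a b => dif_pos ⟨a.2, b.2⟩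
  have hiff : ∀ e : LEdge n, lTau τ e = true → (S (lEdgeEnds e).1 ↔ S (lEdgeEnds e).2) :=
    fun e he => ⟨hS _ _ ⟨e, Or.inl rfl, he⟩, hS _ _ ⟨e, Or.inr rfl, he⟩⟩
  have ice : ∀ i < n, ∀ j < n,
      (H i j = H (i + 1) j → V i j = H i j ∧ V i (j + 1) = H i j) ∧
        (H i j ≠ H (i + 1) j → V i j ≠ V i (j + 1)) := by
    intro i hi j hj
    have h := hτ.green ⟨i, hi⟩ ⟨j, hj⟩
    rwa [← hl, ← hr, ← hb, ← ht] at h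
  obtain ⟨cH, cV, hcV, hc⟩ := exists_colouring_of_components (P := P) ice
    (fun i hi j hj h1 h2 => by
      have hg := (ice i hi j hj).2 h2
      have h := hiff ((⟨i, hi⟩, ⟨j, hj⟩), true)
      simp only [lTau, ← hl, ← hr, ← hb, ← ht] at h
      have h3 := h (by
        revert h1 h2 hg
        cases H i j <;> cases H (i + 1) j <;> cases V i j <;> cases V i (j + 1) <;> simp)
      exact (hP _ _).trans ((decide_eq_decide.2 h3).trans (hP _ _).symm))
    (fun i hi j hj h1 h2 => by
      have hg := (ice i hi j hj).2 h2
      have h := hiff ((⟨i, hi⟩, ⟨j, hj⟩), false)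
      simp only [lTau, ← hl, ← hr, ← hb, ← ht] at h
      have h3 := h (by
        revert h1 h2 hg
        cases H i j <;> cases H (i + 1) j <;> cases V i j <;> cases V i (j + 1) <;> simp)
      exact (hP _ _).trans ((decide_eq_decide.2 h3).trans (hP _ _).symm))
    (fun a ha => (hP ⟨a, by omega⟩ (Fin.last n)).trans
      (decide_eq_false fun h => htop _ h rfl))
  let c : Edge n → Bool := fun e => match e with
    | .horiz k j => cH k j
    | .vert i k => cV i k
  refine ⟨c, fun i => hcV i, fun i j => ?_⟩
  have inc : ∀ {p : Edge n → Prop}, p (leftE i j) → p (rightE i j) → p (botE i j) →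
      p (topE i j) → ∀ e, EdgeIncident e (i, j) → p e := by
    intro p h1 h2 h3 h4 e he
    rcases edgeIncident_iff.1 he with rfl | rfl | rfl | rfl <;> assumption
  obtain ⟨b, ⟨h1, h2, h3, h4, h5⟩ | ⟨h1, h2, h3, h4⟩⟩ := hc i i.2 j j.2
  · refine ⟨Or.inl ⟨b, inc h1 h2 h3 h4⟩, fun hsw hse => ?_⟩
    have hg := h5 ((hP _ _).trans (decide_eq_true hsw)) ((hP _ _).trans (decide_eq_true hse))
    have hm := (ice i i.2 j j.2).1 hg
    rw [hl, hr] at hg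
    rw [hl, hb, ht] at hm
    refine ⟨b ^^ greenB τ (leftE i j), inc ?_ ?_ ?_ ?_⟩
    · rw [show c (leftE i j) = b from h1]
    · rw [show c (rightE i j) = b from h2, hg]
    · rw [show c (botE i j) = b from h3, hm.1]
    · rw [show c (topE i j) = b from h4, hm.2]
  · rw [hl] at h1
    rw [hr] at h2
    rw [hb] at h3
    rw [ht] at h4
    have h := inc (p := fun e => (c e ^^ greenB τ e) = b) h1 h2 h3 h4
    exact ⟨Or.inr ⟨b, h⟩, fun _ _ => ⟨b, h⟩⟩

/-- A function unchanged along the steps of a chain agrees at its two ends. -/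
theorem List.IsChain.apply_head_eq_apply_getLast {α β : Type*} {r : α → α → Prop} {p : List α}
    (hp : p.IsChain r) {f : α → β} (hf : ∀ a ∈ p, ∀ b ∈ p, r a b → f a = f b) {a b : α}
    (ha : p.head? = some a) (hb : p.getLast? = some b) : f a = f b := by
  induction p generalizing a with
  | nil => simp at ha
  | cons x l ih =>
    obtain rfl : x = a := by simpa using ha
    cases l with
    | nil => simp_all
    | cons y l =>
      rw [List.isChain_cons_cons] at hp
      exact (hf x (by simp) y (by simp) hp.1).trans
        (ih hp.2 (fun u hu v hv => hf u (by simp [hu]) v (by simp [hv])) rfl (by simpa using hb))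

/-- if there are both a simple green path and a simple red path
from a vertex of the unit square `s` (with lower-left corner `(i, j)`) to the
top boundary of `Λ_n`, then there is a path of `L_τ`-edges from an
`L_n`-vertex adjacent to `s` to the top boundary of `L_n`. -/
theorem green_red_paths_give_lTau_path (n : ℕ) (hn : 1 ≤ n)
    (τ : EdgeConfig n) (hτ : τ ∈ OmegaSet n) (i j : ℕ)
    (hi : i + 1 < n) (hj : j + 1 < n)
    (hgreen : ∃ p : List (Edge n), MonoPath τ true p ∧
      (∃ e, p.head? = some e ∧ ∃ v : Fin n × Fin n, EdgeIncident e v ∧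
        (v.1.val = i ∨ v.1.val = i + 1) ∧ (v.2.val = j ∨ v.2.val = j + 1)) ∧
      (∃ i', p.getLast? = some (Edge.vert i' (Fin.last n))))
    (hred : ∃ p : List (Edge n), MonoPath τ false p ∧
      (∃ e, p.head? = some e ∧ ∃ v : Fin n × Fin n, EdgeIncident e v ∧
        (v.1.val = i ∨ v.1.val = i + 1) ∧ (v.2.val = j ∨ v.2.val = j + 1)) ∧
      (∃ i', p.getLast? = some (Edge.vert i' (Fin.last n)))) :
    ∃ q : List (LVertex n), q ≠ [] ∧ List.Chain' (LStep τ) q ∧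
      (∃ u, q.head? = some u ∧ i ≤ u.1.val ∧ u.1.val ≤ i + 2 ∧
        j ≤ u.2.val ∧ u.2.val ≤ j + 2) ∧
      (∃ u, q.getLast? = some u ∧ u.2 = Fin.last n) := by
  classical
  by_contra hno
  let S : LVertex n → Prop := fun v => ∃ u : LVertex n,
    (i ≤ u.1.val ∧ u.1.val ≤ i + 2 ∧ j ≤ u.2.val ∧ u.2.val ≤ j + 2) ∧
      Relation.ReflTransGen (LStep τ) u v
  obtain ⟨c, hctop, hc⟩ := exists_colouring_of_closed (S := S) hτ
    (fun _ _ hst ⟨u, hu, h⟩ => ⟨u, hu, h.tail hst⟩)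
    (fun v ⟨u, hu, h⟩ hv => by
      obtain ⟨q, hq, hlast⟩ := List.exists_isChain_cons_of_relationReflTransGen h
      exact hno ⟨u :: q, by simp, hq, ⟨u, rfl, hu⟩,
        ⟨v, by rw [List.getLast?_eq_some_getLast (List.cons_ne_nil _ _), hlast], hv⟩⟩)
  have start : ∀ g, (∃ p : List (Edge n), MonoPath τ g p ∧
      (∃ e, p.head? = some e ∧ ∃ v : Fin n × Fin n, EdgeIncident e v ∧
        (v.1.val = i ∨ v.1.val = i + 1) ∧ (v.2.val = j ∨ v.2.val = j + 1)) ∧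
      (∃ i', p.getLast? = some (Edge.vert i' (Fin.last n)))) →
      ∃ v : Fin n × Fin n, ∃ e, EdgeIncident e v ∧ (c e ^^ greenB τ e) = g ∧
        (v.1.val = i ∨ v.1.val = i + 1) ∧ (v.2.val = j ∨ v.2.val = j + 1) := by
    rintro g ⟨p, ⟨-, -, hp, hg⟩, ⟨e, he, v, hev, hv⟩, i', hi'⟩
    have hce : c e = c (Edge.vert i' (Fin.last n)) := by
      refine hp.apply_head_eq_apply_getLast (fun a ha b hb hab => ?_) he hi'
      obtain ⟨-, w, haw, hbw⟩ := hab
      obtain ⟨x, hx⟩ | ⟨x, hx⟩ := (hc w.1 w.2).1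
      · rw [hx a haw, hx b hbw]
      · have h := (hx a haw).trans (hx b hbw).symm
        rw [hg a ha, hg b hb] at h
        exact Bool.xor_left_inj.1 h
    refine ⟨v, e, hev, ?_, hv⟩
    rw [hce, hctop, hg e (List.mem_of_mem_head? he), Bool.false_xor]
  have window : ∀ a b : Fin n, (a.val = i ∨ a.val = i + 1) → (b.val = j ∨ b.val = j + 1) →
      ∃ x, ∀ e, EdgeIncident e (a, b) → (c e ^^ greenB τ e) = x := by
    intro a b ha hb
    refine (hc a b).2 ⟨_, ⟨?_, ?_, ?_, ?_⟩, .refl⟩ ⟨_, ⟨?_, ?_, ?_, ?_⟩, .refl⟩ <;> simp <;> omega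
  let i₀ : Fin n := ⟨i, by omega⟩
  let i₁ : Fin n := ⟨i + 1, hi⟩
  let j₀ : Fin n := ⟨j, by omega⟩
  let j₁ : Fin n := ⟨j + 1, hj⟩
  obtain ⟨x₀₀, h₀₀⟩ := window i₀ j₀ (Or.inl rfl) (Or.inl rfl)
  obtain ⟨x₁₀, h₁₀⟩ := window i₁ j₀ (Or.inr rfl) (Or.inl rfl)
  obtain ⟨x₀₁, h₀₁⟩ := window i₀ j₁ (Or.inl rfl) (Or.inr rfl)
  obtain ⟨x₁₁, h₁₁⟩ := window i₁ j₁ (Or.inr rfl) (Or.inr rfl)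
  obtain rfl : x₁₀ = x₀₀ := (h₁₀ (rightE i₀ j₀) ⟨rfl, Or.inl rfl⟩).symm.trans
    (h₀₀ _ ⟨rfl, Or.inr rfl⟩)
  obtain rfl : x₀₁ = x₁₀ := (h₀₁ (topE i₀ j₀) ⟨rfl, Or.inl rfl⟩).symm.trans
    (h₀₀ _ ⟨rfl, Or.inr rfl⟩)
  obtain rfl : x₁₁ = x₀₁ := (h₁₁ (topE i₁ j₀) ⟨rfl, Or.inl rfl⟩).symm.trans
    (h₁₀ _ ⟨rfl, Or.inr rfl⟩)
  have all : ∀ g, (∃ v : Fin n × Fin n, ∃ e, EdgeIncident e v ∧ (c e ^^ greenB τ e) = g ∧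
      (v.1.val = i ∨ v.1.val = i + 1) ∧ (v.2.val = j ∨ v.2.val = j + 1)) → g = x₁₁ := by
    rintro g ⟨⟨a, b⟩, e, he, rfl, ha, hb⟩
    rcases ha with ha | ha <;> rcases hb with hb | hb
    · obtain rfl : a = i₀ := Fin.ext ha
      obtain rfl : b = j₀ := Fin.ext hb
      exact h₀₀ e he
    · obtain rfl : a = i₀ := Fin.ext ha
      obtain rfl : b = j₁ := Fin.ext hb
      exact h₀₁ e he
    · obtain rfl : a = i₁ := Fin.ext ha
      obtain rfl : b = j₀ := Fin.ext hb
      exact h₁₀ e he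
    · obtain rfl : a = i₁ := Fin.ext ha
      obtain rfl : b = j₁ := Fin.ext hb
      exact h₁₁ e he
  exact Bool.false_ne_true ((all _ (start _ hred)).trans (all _ (start _ hgreen)).symm)
end
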